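/- arXiv:1704.08423 — 3 statements merged into one kernel-verified Lean document; each statement's English description precedes it below -/
import Mathlib

section
/- Let 1 < α < 2 and E, A ∈ ℝ^{n×n}. The triplet (E, A, α) is admissible if and only if there exist a symmetric positive definite matrix P ∈ ℝ^{n×n} and a symmetric matrix Q ∈ ℝ^{n×n} such that Sym{Θ⊗(AᵀPE)} + I₂⊗(AᵀQA) is negative definite and EᵀQE is positive semidefinite, where Θ = [[sin(απ/2), −cos(απ/2)], [cos(απ/2), sin(απ/2)]]. -/
open Matrix Kronecker

/-- The reindexing equivalence for a block splitting `n = r + s`. -/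
def blockEquiv {n r s : ℕ} (h : n = r + s) : Fin r ⊕ Fin s ≃ Fin n :=
  finSumFinEquiv.trans (finCongr h.symm)

/-- `Sym M = M + Mᵀ`. -/
def matSym {m : Type*} (M : Matrix m m ℝ) : Matrix m m ℝ := M + Mᵀ

/-- A real matrix is negative definite iff its negation is positive definite. -/
def NegDef {m : Type*} [Fintype m] (M : Matrix m m ℝ) : Prop := (-M).PosDef

/-- The pencil `(E, A)` is regular and impulse-free: for some `r`, invertible `M, N` give
`M E N = diag(I_r, 0)` and `M A N = diag(A₁, I_{n-r})`. -/
def RegularImpulseFree {n : ℕ} (E A : Matrix (Fin n) (Fin n) ℝ) : Prop :=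
  ∃ (r s : ℕ) (h : n = r + s) (M N : Matrix (Fin n) (Fin n) ℝ)
    (A₁ : Matrix (Fin r) (Fin r) ℝ),
    IsUnit M ∧ IsUnit N ∧
    (M * E * N).submatrix (blockEquiv h) (blockEquiv h) = Matrix.fromBlocks 1 0 0 0 ∧
    (M * A * N).submatrix (blockEquiv h) (blockEquiv h) = Matrix.fromBlocks A₁ 0 0 1

/-- The triplet `(E, A, α)` is admissible: regular, impulse-free, and every finite
eigenvalue `λ` of the pencil satisfies `|arg λ| > απ/2`. -/
def Admissible {n : ℕ} (E A : Matrix (Fin n) (Fin n) ℝ) (α : ℝ) : Prop :=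
  RegularImpulseFree E A ∧
  ∀ lam : ℂ, (lam • E.map Complex.ofReal - A.map Complex.ofReal).det = 0 →
    α * Real.pi / 2 < |lam.arg|

/-- The matrix `Θ = [[sin(απ/2), −cos(απ/2)], [cos(απ/2), sin(απ/2)]]`. -/
noncomputable def Θmat (α : ℝ) : Matrix (Fin 2) (Fin 2) ℝ :=
  !![Real.sin (α * Real.pi / 2), -Real.cos (α * Real.pi / 2);
     Real.cos (α * Real.pi / 2),  Real.sin (α * Real.pi / 2)]

theorem norm_mul_mul_dotProduct_le {ι : Type*} [Fintype ι] {w : ℂ} (hw : ‖w‖ ≤ 1) (a : ℂ)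
    (m u : ι → ℂ) {ν : ℝ} (hν : 0 < ν) :
    (w * (a * (star m ⬝ᵥ u))).re ≤
      ν / 2 * ∑ i, ‖m i‖ ^ 2 + (∑ i, ‖u i‖ ^ 2) / (2 * ν) * ‖a‖ ^ 2 := by
  have h1 : (w * (a * (star m ⬝ᵥ u))).re ≤ ∑ i, ‖a‖ * (‖m i‖ * ‖u i‖) := by
    refine (Complex.re_le_norm _).trans ?_
    rw [norm_mul, norm_mul, ← Finset.mul_sum]
    refine (mul_le_of_le_one_left (by positivity) hw).trans ?_
    refine mul_le_mul_of_nonneg_left ?_ (norm_nonneg _)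
    refine (norm_sum_le _ _).trans (le_of_eq ?_)
    simp
  refine h1.trans ?_
  rw [Finset.mul_sum, Finset.sum_div, Finset.sum_mul, ← Finset.sum_add_distrib]
  refine Finset.sum_le_sum fun i _ ↦ ?_
  have h2 : ν / 2 * ‖m i‖ ^ 2 + ‖u i‖ ^ 2 / (2 * ν) * ‖a‖ ^ 2 - ‖a‖ * (‖m i‖ * ‖u i‖)
      = (ν * ‖m i‖ - ‖a‖ * ‖u i‖) ^ 2 / (2 * ν) := by
    field_simp
    ring
  have h3 : 0 ≤ (ν * ‖m i‖ - ‖a‖ * ‖u i‖) ^ 2 / (2 * ν) := by positivity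
  linarith

/-- An endomorphism whose eigenvalues lie in the cone `{z | ∀ w ∈ S, re (w z) < 0}` admits a
Hermitian inner product for which its numerical range lies in that cone. -/
theorem exists_injective_re_dotProduct_le (S : Set ℂ) (hS : ∀ w ∈ S, ‖w‖ ≤ 1) (n : ℕ) :
    ∀ (V : Type) [AddCommGroup V] [Module ℂ V] [FiniteDimensional ℂ V] (T : Module.End ℂ V),
      Module.finrank ℂ V = n →
      (∀ z, T.HasEigenvalue z → ∃ μ > 0, ∀ w ∈ S, (w * z).re ≤ -μ) →
      ∃ (ι : Type) (_ : Fintype ι) (L : V →ₗ[ℂ] (ι → ℂ)), Function.Injective L ∧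
        ∃ ν > 0, ∀ w ∈ S, ∀ x,
          (w * (star (L x) ⬝ᵥ L (T x))).re ≤ -ν * ∑ i, ‖L x i‖ ^ 2 := by
  induction n with
  | zero =>
    intro V _ _ _ T hV _
    have := Module.finrank_zero_iff.1 hV
    exact ⟨Empty, inferInstance, 0, Function.injective_of_subsingleton _, 1, one_pos, by simp⟩
  | succ n ih =>
    intro V _ _ _ T hV hT
    have : Nontrivial V := Module.nontrivial_of_finrank_pos (R := ℂ) (by omega)
    obtain ⟨z, hz⟩ := Module.End.exists_eigenvalue (K := ℂ) (V := Module.Dual ℂ V)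
      (Module.Dual.transpose (R := ℂ) T)
    obtain ⟨f, hf⟩ := hz.exists_hasEigenvector
    have hf0 : f ≠ 0 := hf.2
    have hfT : ∀ x, f (T x) = z * f x := fun x ↦ by
      have := LinearMap.congr_fun hf.apply_eq_smul x
      rwa [Module.Dual.transpose_apply] at this
    obtain ⟨y, hy⟩ : ∃ y, f y = 1 := LinearMap.surjective hf0 1
    have hzT : T.HasEigenvalue z := by
      rw [Module.End.hasEigenvalue_iff_mem_spectrum, spectrum.mem_iff]
      intro hu
      obtain ⟨x, hx⟩ := ((Module.End.isUnit_iff _).1 hu).2 y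
      have := congrArg f hx
      simp [hfT, hy, Module.algebraMap_end_apply] at this
    obtain ⟨μ, hμ, hμz⟩ := hT z hzT
    have hinv : ∀ x ∈ LinearMap.ker f, T x ∈ LinearMap.ker f := fun x hx ↦ by
      rw [LinearMap.mem_ker] at hx ⊢
      rw [hfT, hx, mul_zero]
    have hdim : Module.finrank ℂ (LinearMap.ker f) = n := by
      have h1 := LinearMap.finrank_range_add_finrank_ker f
      rw [LinearMap.range_eq_top.2 (LinearMap.surjective hf0), finrank_top] at h1
      simp at h1
      omega
    obtain ⟨ι, _, L, hL, ν, hν, hLν⟩ := ih (LinearMap.ker f) (T.restrict hinv) hdim (by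
      intro c hc
      refine hT c ?_
      obtain ⟨v, hv⟩ := hc.exists_hasEigenvector
      refine Module.End.hasEigenvalue_of_hasEigenvector (x := (v : V)) ⟨?_, ?_⟩
      · rw [Module.End.mem_eigenspace_iff]
        simpa using congrArg Subtype.val hv.apply_eq_smul
      · simpa using hv.2)
    let p : V →ₗ[ℂ] LinearMap.ker f :=
      (LinearMap.id - f.smulRight y).codRestrict (LinearMap.ker f) (fun x ↦ by simp [hy])
    have hp : ∀ x, (p x : V) = x - f x • y := fun x ↦ rfl
    have hu : T y - z • y ∈ LinearMap.ker f := by simp [hfT, hy]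
    have hpT : ∀ x, p (T x) = T.restrict hinv (p x) + f x • ⟨T y - z • y, hu⟩ := fun x ↦ by
      ext
      simp [hp, hfT, LinearMap.restrict_apply]
      module
    set u : ι → ℂ := L ⟨T y - z • y, hu⟩ with hu_def
    set U : ℝ := ∑ i, ‖u i‖ ^ 2 with hU
    have hU0 : 0 ≤ U := by positivity
    obtain ⟨k, hk, hk2⟩ : ∃ k : ℝ, 0 < k ∧ k ^ 2 = U / (μ * ν) + 1 :=
      ⟨√(U / (μ * ν) + 1), by positivity, Real.sq_sqrt (by positivity)⟩
    let L' : V →ₗ[ℂ] (Unit ⊕ ι → ℂ) :=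
      { toFun := fun x ↦ Sum.elim (fun _ ↦ (k : ℂ) * f x) (L (p x))
        map_add' := fun x x' ↦ by ext (i | i) <;> simp [mul_add]
        map_smul' := fun c x ↦ by ext (i | i) <;> simp; ring }
    have hL' : ∀ x, L' x = Sum.elim (fun _ ↦ (k : ℂ) * f x) (L (p x)) := fun x ↦ rfl
    refine ⟨Unit ⊕ ι, inferInstance, L', ?_, min μ ν / 2, by positivity, ?_⟩
    · rw [← LinearMap.ker_eq_bot, LinearMap.ker_eq_bot']
      intro x hx
      rw [hL'] at hx
      have h1 : f x = 0 := by simpa [hk.ne'] using congrFun hx (Sum.inl ())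
      have h2 : L (p x) = 0 := by
        ext i
        simpa using congrFun hx (Sum.inr i)
      have h3 : p x = 0 := hL (by rw [h2, map_zero])
      have h4 := hp x
      simpa [h3, h1] using h4.symm
    · intro w hw x
      have hsplit : w * (star (L' x) ⬝ᵥ L' (T x)) =
          (k ^ 2 * ‖f x‖ ^ 2 : ℝ) * (w * z) + w * (star (L (p x)) ⬝ᵥ L (T.restrict hinv (p x)))
            + w * (f x * (star (L (p x)) ⬝ᵥ u)) := by
        have h0 : ((‖f x‖ : ℝ) : ℂ) ^ 2 = star (f x) * f x := by
          simpa using (Complex.conj_mul' (f x)).symm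
        rw [hL', hL', hpT, hfT, map_add, map_smul, ← hu_def]
        simp only [dotProduct, Fintype.sum_sum_type, Pi.star_apply, Sum.elim_inl, Sum.elim_inr,
          Finset.univ_unique, Finset.sum_singleton, Pi.add_apply, Pi.smul_apply, smul_eq_mul,
          mul_add, Finset.sum_add_distrib, Finset.mul_sum]
        push_cast
        rw [h0]
        simp only [star_mul', Complex.star_def, Complex.conj_ofReal]
        rw [add_assoc]
        congr 1
        · ring
        · congr 1
          exact Finset.sum_congr rfl fun i _ ↦ by ring
      have hsum : ∑ i, ‖L' x i‖ ^ 2 = k ^ 2 * ‖f x‖ ^ 2 + ∑ i, ‖L (p x) i‖ ^ 2 := by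
        simp [hL', mul_pow]
      rw [hsplit, hsum, Complex.add_re, Complex.add_re, Complex.re_ofReal_mul]
      have h1 := hLν w hw (p x)
      have h2 := norm_mul_mul_dotProduct_le (hS w hw) (f x) (L (p x)) u hν
      have h3 := mul_le_mul_of_nonneg_left (hμz w hw) (by positivity : 0 ≤ k ^ 2 * ‖f x‖ ^ 2)
      set m := ∑ i, ‖L (p x) i‖ ^ 2 with hm
      have hm0 : 0 ≤ m := by positivity
      have h4 : U / (2 * ν) ≤ μ / 2 * k ^ 2 := by
        have : μ / 2 * k ^ 2 = U / (2 * ν) + μ / 2 := by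
          rw [hk2]; field_simp
        linarith
      have h5 := mul_le_mul_of_nonneg_right h4 (by positivity : 0 ≤ ‖f x‖ ^ 2)
      have h6 := mul_le_mul_of_nonneg_right (min_le_left μ ν)
        (by positivity : 0 ≤ k ^ 2 * ‖f x‖ ^ 2)
      have h7 := mul_le_mul_of_nonneg_right (min_le_right μ ν) hm0
      linarith

theorem sector_re_neg {φ : ℝ} (hφ₁ : Real.pi / 2 < φ) (hφ₂ : φ < Real.pi) {z : ℂ}
    (hz : φ < |z.arg|) :
    Real.sin φ * z.re + Real.cos φ * z.im < 0 ∧ Real.sin φ * z.re - Real.cos φ * z.im < 0 := by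
  have hpi := Real.pi_pos
  have hz0 : z ≠ 0 := by
    rintro rfl
    simp at hz
    linarith
  have hn : 0 < ‖z‖ := norm_pos_iff.2 hz0
  have hle := Complex.abs_arg_le_pi z
  have h1 : Real.sin (φ - |z.arg|) < 0 :=
    Real.sin_neg_of_neg_of_neg_pi_lt (by linarith) (by linarith)
  have h2 : Real.sin (φ + |z.arg|) < 0 := by
    have := Real.sin_neg_of_neg_of_neg_pi_lt (x := φ + |z.arg| - 2 * Real.pi) (by linarith)
      (by linarith)
    rwa [Real.sin_sub_two_pi] at this
  have hre : z.re = ‖z‖ * Real.cos z.arg := (Complex.norm_mul_cos_arg z).symm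
  have him : z.im = ‖z‖ * Real.sin z.arg := (Complex.norm_mul_sin_arg z).symm
  have h3 : Real.sin (φ + z.arg) < 0 ∧ Real.sin (φ - z.arg) < 0 := by
    rcases abs_cases z.arg with ⟨h, -⟩ | ⟨h, -⟩ <;> rw [h] at h1 h2
    · exact ⟨h2, h1⟩
    · rw [sub_neg_eq_add] at h1
      rw [← sub_eq_add_neg] at h2
      exact ⟨h1, h2⟩
  rw [Real.sin_add, Real.sin_sub] at h3
  rw [hre, him]
  constructor
  · nlinarith [mul_neg_of_pos_of_neg hn h3.1]
  · nlinarith [mul_neg_of_pos_of_neg hn h3.2]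

theorem sector_of_re_neg {φ : ℝ} (hφ : φ < Real.pi) {z : ℂ}
    (h₁ : Real.sin φ * z.re + Real.cos φ * z.im < 0)
    (h₂ : Real.sin φ * z.re - Real.cos φ * z.im < 0) : φ < |z.arg| := by
  by_contra! hle
  have h3 : 0 ≤ Real.sin (φ - |z.arg|) :=
    Real.sin_nonneg_of_nonneg_of_le_pi (by linarith) (by linarith [abs_nonneg z.arg])
  have hre : z.re = ‖z‖ * Real.cos z.arg := (Complex.norm_mul_cos_arg z).symm
  have him : z.im = ‖z‖ * Real.sin z.arg := (Complex.norm_mul_sin_arg z).symm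
  have h4 := mul_nonneg (norm_nonneg z) h3
  rw [hre, him] at h₁ h₂
  rcases abs_cases z.arg with ⟨h, -⟩ | ⟨h, -⟩ <;> rw [h] at h4
  · rw [Real.sin_sub] at h4
    linarith
  · rw [sub_neg_eq_add, Real.sin_add] at h4
    linarith

/-- The quadratic form `(u, v) ↦ (u, v)ᵀ (Θ ⊗ X) (u, v)`. -/
noncomputable def sectorForm {ι : Type*} [Fintype ι] (φ : ℝ) (X : Matrix ι ι ℝ) (u v : ι → ℝ) : ℝ :=
  Real.sin φ * (u ⬝ᵥ X *ᵥ u + v ⬝ᵥ X *ᵥ v) - Real.cos φ * (u ⬝ᵥ X *ᵥ v)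
    + Real.cos φ * (v ⬝ᵥ X *ᵥ u)

theorem exists_posDef_sectorForm_neg {ι : Type} [Fintype ι] [DecidableEq ι] {φ : ℝ}
    (hφ₁ : Real.pi / 2 < φ) (hφ₂ : φ < Real.pi) (A : Matrix ι ι ℝ)
    (hA : ∀ z : ℂ, (z • (1 : Matrix ι ι ℂ) - A.map Complex.ofReal).det = 0 → φ < |z.arg|) :
    ∃ P : Matrix ι ι ℝ, P.PosDef ∧ ∀ u v : ι → ℝ, (u ≠ 0 ∨ v ≠ 0) →
      sectorForm φ (Aᵀ * P) u v < 0 := by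
  let w : ℂ := ⟨Real.sin φ, -Real.cos φ⟩
  let w' : ℂ := ⟨Real.sin φ, Real.cos φ⟩
  let T : Module.End ℂ (ι → ℂ) := Matrix.toLin' (A.map Complex.ofReal)
  have hS : ∀ x ∈ ({w, w'} : Set ℂ), ‖x‖ ≤ 1 := by
    rintro x (rfl | rfl) <;> rw [← sq_le_one_iff₀ (norm_nonneg _), Complex.sq_norm,
      Complex.normSq_mk] <;> nlinarith [Real.sin_sq_add_cos_sq φ]
  obtain ⟨κ, _, L, hL, ν, hν, hLν⟩ := exists_injective_re_dotProduct_le {w, w'} hS _ (ι → ℂ) T rfl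
    (by
      intro z hz
      obtain ⟨x, hx⟩ := hz.exists_hasEigenvector
      have hdet : (z • (1 : Matrix ι ι ℂ) - A.map Complex.ofReal).det = 0 := by
        refine Matrix.exists_mulVec_eq_zero_iff.1 ⟨x, hx.2, ?_⟩
        have := hx.apply_eq_smul
        rw [Matrix.toLin'_apply] at this
        rw [Matrix.sub_mulVec, this, Matrix.smul_mulVec, Matrix.one_mulVec, sub_self]
      obtain ⟨h1, h2⟩ := sector_re_neg hφ₁ hφ₂ (hA z hdet)
      refine ⟨min (-(Real.sin φ * z.re + Real.cos φ * z.im))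
        (-(Real.sin φ * z.re - Real.cos φ * z.im)), by
          rw [gt_iff_lt, lt_min_iff]; constructor <;> linarith, ?_⟩
      rintro x (rfl | rfl)
      · simp only [w, Complex.mul_re]
        linarith [min_le_left (-(Real.sin φ * z.re + Real.cos φ * z.im))
          (-(Real.sin φ * z.re - Real.cos φ * z.im))]
      · simp only [w', Complex.mul_re]
        linarith [min_le_right (-(Real.sin φ * z.re + Real.cos φ * z.im))
          (-(Real.sin φ * z.re - Real.cos φ * z.im))])
  let cast : (ι → ℝ) → (ι → ℂ) := fun x i ↦ (x i : ℂ)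
  let K : Matrix (κ ⊕ κ) ι ℝ := Matrix.fromRows ((LinearMap.toMatrix' L).map Complex.re)
    ((LinearMap.toMatrix' L).map Complex.im)
  have hLK : ∀ x i, L (cast x) i = ⟨(K *ᵥ x) (Sum.inl i), (K *ᵥ x) (Sum.inr i)⟩ := by
    intro x i
    have h1 : L (cast x) = LinearMap.toMatrix' L *ᵥ cast x := by
      rw [← Matrix.toLin'_apply, Matrix.toLin'_toMatrix']
    rw [h1]
    apply Complex.ext <;> simp [K, Matrix.mulVec, dotProduct, cast]
  have hcast0 : ∀ x, cast x = 0 → x = 0 := fun x hx ↦ by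
    ext i
    simpa [cast] using congrFun hx i
  have hK : Function.Injective K.mulVec := by
    rw [← Matrix.coe_mulVecLin, ← LinearMap.ker_eq_bot, LinearMap.ker_eq_bot']
    intro x hx
    rw [Matrix.mulVecLin_apply] at hx
    refine hcast0 x (hL ?_)
    ext i
    rw [hLK, hx, map_zero]
    rfl
  have hform : ∀ x y, x ⬝ᵥ (Aᵀ * (Kᵀ * K)) *ᵥ y =
      (star (L (cast y)) ⬝ᵥ L (cast (A *ᵥ x))).re := by
    intro x y
    have h1 : x ⬝ᵥ (Aᵀ * (Kᵀ * K)) *ᵥ y = (K *ᵥ (A *ᵥ x)) ⬝ᵥ (K *ᵥ y) := by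
      rw [← Matrix.mul_assoc, ← Matrix.transpose_mul, ← Matrix.mulVec_mulVec,
        Matrix.dotProduct_mulVec, Matrix.vecMul_transpose, Matrix.mulVec_mulVec]
    rw [h1]
    simp only [dotProduct, Fintype.sum_sum_type, Pi.star_apply, hLK, Complex.re_sum]
    rw [← Finset.sum_add_distrib]
    refine Finset.sum_congr rfl fun i _ ↦ ?_
    simp
    ring
  refine ⟨Kᵀ * K, by simpa using Matrix.PosDef.conjTranspose_mul_self K hK, ?_⟩
  intro u v huv
  have hT : ∀ (c : ℂ) , T (cast u + c • cast v) = cast (A *ᵥ u) + c • cast (A *ᵥ v) := by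
    intro c
    have : ∀ x, T (cast x) = cast (A *ᵥ x) := fun x ↦ by
      ext i
      simp [T, cast, Matrix.mulVec, dotProduct]
    rw [map_add, map_smul, this, this]
  have hne : L (cast u + Complex.I • cast v) ≠ 0 := by
    intro h
    have h1 : cast u + Complex.I • cast v = 0 := hL (by rw [h, map_zero])
    have h2 : ∀ i, u i = 0 ∧ v i = 0 := fun i ↦ by
      have := congrFun h1 i
      simpa [cast, Complex.ext_iff] using this
    rcases huv with h | h
    · exact h (funext fun i ↦ (h2 i).1)
    · exact h (funext fun i ↦ (h2 i).2)
  have h1 := hLν w (by simp) (cast u + Complex.I • cast v)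
  have h2 := hLν w' (by simp) (cast u + (-Complex.I) • cast v)
  have h3 : 0 < ∑ i, ‖L (cast u + Complex.I • cast v) i‖ ^ 2 := by
    obtain ⟨i, hi⟩ := Function.ne_iff.1 hne
    exact Finset.sum_pos' (fun _ _ ↦ by positivity)
      ⟨i, Finset.mem_univ _, by have := norm_pos_iff.2 hi; positivity⟩
  have h4 : 0 ≤ ∑ i, ‖L (cast u + (-Complex.I) • cast v) i‖ ^ 2 := by positivity
  have h5 := mul_pos hν h3
  have h6 := mul_nonneg hν.le h4
  rw [hT] at h1 h2
  have h7 : (w * (star (L (cast u + Complex.I • cast v)) ⬝ᵥ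
        L (cast (A *ᵥ u) + Complex.I • cast (A *ᵥ v)))).re +
      (w' * (star (L (cast u + (-Complex.I) • cast v)) ⬝ᵥ
        L (cast (A *ᵥ u) + (-Complex.I) • cast (A *ᵥ v)))).re =
      2 * sectorForm φ (Aᵀ * (Kᵀ * K)) u v := by
    simp only [sectorForm, hform, map_add, map_smul, star_add, star_smul, add_dotProduct,
      dotProduct_add, smul_dotProduct, dotProduct_smul, w, w']
    simp [Complex.mul_re, Complex.add_re, Complex.mul_im]
    ring
  linarith

theorem dotProduct_transpose_mulVec_self {m : Type*} [Fintype m] (M : Matrix m m ℝ) (x : m → ℝ) :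
    x ⬝ᵥ Mᵀ *ᵥ x = x ⬝ᵥ M *ᵥ x := by
  rw [Matrix.mulVec_transpose, dotProduct_comm, ← Matrix.dotProduct_mulVec]

theorem dotProduct_kronecker_mulVec {ι : Type*} [Fintype ι] (B : Matrix (Fin 2) (Fin 2) ℝ)
    (X : Matrix ι ι ℝ) (x : Fin 2 × ι → ℝ) :
    x ⬝ᵥ (B ⊗ₖ X) *ᵥ x =
      ∑ i, ∑ j, B i j * ((fun a ↦ x (i, a)) ⬝ᵥ X *ᵥ fun a ↦ x (j, a)) := by
  simp only [dotProduct, Matrix.mulVec, Fintype.sum_prod_type, Matrix.kroneckerMap_apply,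
    Finset.mul_sum]
  refine Finset.sum_congr rfl fun i _ ↦ ?_
  rw [Finset.sum_comm]
  refine Finset.sum_congr rfl fun j _ ↦ Finset.sum_congr rfl fun a _ ↦
    Finset.sum_congr rfl fun b _ ↦ ?_
  ring

theorem negDef_iff_sectorForm {ι : Type*} [Fintype ι] (α : ℝ) (X Y : Matrix ι ι ℝ)
    (hY : Y.IsSymm) :
    NegDef (matSym (Θmat α ⊗ₖ X) + (1 : Matrix (Fin 2) (Fin 2) ℝ) ⊗ₖ Y) ↔
      ∀ u v : ι → ℝ, (u ≠ 0 ∨ v ≠ 0) →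
        2 * sectorForm (α * Real.pi / 2) X u v + u ⬝ᵥ Y *ᵥ u + v ⬝ᵥ Y *ᵥ v < 0 := by
  have hform : ∀ x : Fin 2 × ι → ℝ,
      star x ⬝ᵥ (-(matSym (Θmat α ⊗ₖ X) + (1 : Matrix (Fin 2) (Fin 2) ℝ) ⊗ₖ Y)) *ᵥ x =
      -(2 * sectorForm (α * Real.pi / 2) X (fun a ↦ x (0, a)) (fun a ↦ x (1, a)) +
        (fun a ↦ x (0, a)) ⬝ᵥ Y *ᵥ (fun a ↦ x (0, a)) +
        (fun a ↦ x (1, a)) ⬝ᵥ Y *ᵥ (fun a ↦ x (1, a))) := by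
    intro x
    rw [star_trivial, Matrix.neg_mulVec, dotProduct_neg, Matrix.add_mulVec, dotProduct_add, matSym,
      Matrix.add_mulVec, dotProduct_add, dotProduct_transpose_mulVec_self,
      dotProduct_kronecker_mulVec, dotProduct_kronecker_mulVec]
    simp [Fin.sum_univ_two, Θmat, sectorForm]
    ring
  have hsymm : (-(matSym (Θmat α ⊗ₖ X) + (1 : Matrix (Fin 2) (Fin 2) ℝ) ⊗ₖ Y)).IsHermitian := by
    have h1 : ((1 : Matrix (Fin 2) (Fin 2) ℝ) ⊗ₖ Y)ᵀ = (1 : Matrix (Fin 2) (Fin 2) ℝ) ⊗ₖ Y := by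
      rw [← Matrix.kroneckerMap_transpose, hY, Matrix.transpose_one]
    rw [Matrix.IsHermitian, Matrix.conjTranspose_eq_transpose_of_trivial, Matrix.transpose_neg,
      Matrix.transpose_add, h1, matSym, Matrix.transpose_add,
      Matrix.transpose_transpose, add_comm (_ ⊗ₖ _)ᵀ]
  rw [NegDef, Matrix.posDef_iff_dotProduct_mulVec]
  constructor
  · rintro ⟨-, h⟩ u v huv
    have h1 := @h (fun p ↦ ![u, v] p.1 p.2) (by
      intro h0
      rcases huv with h | h
      · exact h (funext fun i ↦ by simpa using congrFun h0 (0, i))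
      · exact h (funext fun i ↦ by simpa using congrFun h0 (1, i)))
    rw [hform] at h1
    simpa using neg_pos.1 h1
  · refine fun h ↦ ⟨hsymm, fun x hx ↦ ?_⟩
    rw [hform, neg_pos]
    refine h _ _ ?_
    by_contra! h0
    refine hx (funext fun ⟨i, a⟩ ↦ ?_)
    fin_cases i
    · exact congrFun h0.1 a
    · exact congrFun h0.2 a

theorem regularImpulseFree_of_disjoint {n : ℕ} {E A : Matrix (Fin n) (Fin n) ℝ} (hA : IsUnit A)
    (h : ∀ z w : Fin n → ℝ, E *ᵥ z = 0 → A *ᵥ z = E *ᵥ w → z = 0) : RegularImpulseFree E A := by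
  let B := A⁻¹ * E
  have hAB : A * B = E :=
    Matrix.mul_nonsing_inv_cancel_left _ _ ((Matrix.isUnit_iff_isUnit_det _).1 hA)
  let T := Matrix.toLin' B
  have hTB : ∀ x, T x = B *ᵥ x := fun x ↦ Matrix.toLin'_apply _ _
  have hdisj : Disjoint (LinearMap.range T) (LinearMap.ker T) := by
    rw [Submodule.disjoint_def]
    rintro z ⟨w, rfl⟩ hz
    rw [LinearMap.mem_ker, hTB] at hz
    refine h _ w ?_ ?_
    · rw [← hAB, ← Matrix.mulVec_mulVec, hz, Matrix.mulVec_zero]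
    · rw [hTB, Matrix.mulVec_mulVec, hAB]
  have hdim := LinearMap.finrank_range_add_finrank_ker T
  have hc : IsCompl (LinearMap.range T) (LinearMap.ker T) :=
    (Submodule.isCompl_iff_disjoint _ _ (by rw [hdim])).2 hdisj
  set r := Module.finrank ℝ (LinearMap.range T) with hr
  set s := Module.finrank ℝ (LinearMap.ker T) with hs
  have hn : n = r + s := by simpa using hdim.symm
  let b₁ : Module.Basis (Fin r) ℝ (LinearMap.range T) := Module.finBasis ℝ _
  let b₂ : Module.Basis (Fin s) ℝ (LinearMap.ker T) := Module.finBasis ℝ _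
  let b : Module.Basis (Fin r ⊕ Fin s) ℝ (Fin n → ℝ) :=
    (b₁.prod b₂).map (Submodule.prodEquivOfIsCompl _ _ hc)
  have hb₁ : ∀ i, b (Sum.inl i) = b₁ i := fun i ↦ by simp [b]
  have hb₂ : ∀ i, b (Sum.inr i) = b₂ i := fun i ↦ by simp [b]
  have hrepr : ∀ x (i : Fin s), b.repr (T x) (Sum.inr i) = 0 := by
    intro x i
    have : (Submodule.prodEquivOfIsCompl _ _ hc).symm (T x) = (⟨T x, ⟨x, rfl⟩⟩, 0) := by
      rw [LinearEquiv.symm_apply_eq]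
      simp
    simp [b, this]
  let C := LinearMap.toMatrix b b T
  let B₁ := C.toBlocks₁₁
  have hC : C = Matrix.fromBlocks B₁ 0 0 0 := by
    ext i j
    rcases i with i | i <;> rcases j with j | j
    · rfl
    · have : T (b₂ j) = 0 := (b₂ j).2
      simp [C, LinearMap.toMatrix_apply, hb₂, this]
    · simp [C, LinearMap.toMatrix_apply, hrepr]
    · simp [C, LinearMap.toMatrix_apply, hrepr]
  have hB₁ : IsUnit B₁ := by
    rw [← Matrix.mulVec_injective_iff_isUnit, ← Matrix.coe_mulVecLin, ← LinearMap.ker_eq_bot,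
      LinearMap.ker_eq_bot']
    intro x hx
    rw [Matrix.mulVecLin_apply] at hx
    let y : LinearMap.range T := ∑ i, x i • b₁ i
    have hy : ⇑(b.repr y) = Sum.elim x 0 := by
      have h1 : (y : Fin n → ℝ) = ∑ i, (Sum.elim x 0 : Fin r ⊕ Fin s → ℝ) i • b i := by
        simp [y, hb₁]
      ext i
      rw [h1, b.repr_sum_self]
    have hTy : T y = 0 := by
      apply b.repr.injective
      have h2 := LinearMap.toMatrix_mulVec_repr b b T y
      ext i
      rw [← h2, hy]
      change (C *ᵥ _) i = _
      rw [hC, Matrix.fromBlocks_mulVec]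
      rcases i with i | i <;> simp [hx]
    have hy0 : (y : Fin n → ℝ) = 0 := (Submodule.disjoint_def.1 hdisj) _ y.2 hTy
    rw [hy0] at hy
    ext i
    simpa using (congrFun hy (Sum.inl i)).symm
  let e := blockEquiv hn
  let std : Module.Basis (Fin n) ℝ (Fin n → ℝ) := Pi.basisFun ℝ (Fin n)
  let N' : Matrix (Fin n) (Fin r ⊕ Fin s) ℝ := std.toMatrix b
  let W' : Matrix (Fin r ⊕ Fin s) (Fin n) ℝ := b.toMatrix std
  have hNW : N' * W' = 1 := Module.Basis.toMatrix_mul_toMatrix_flip _ _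
  have hWN : W' * N' = 1 := Module.Basis.toMatrix_mul_toMatrix_flip _ _
  have hWBN : W' * B * N' = C := by
    have : LinearMap.toMatrix std std T = B := LinearMap.toMatrix'_toLin' B
    rw [← this]
    exact basis_toMatrix_mul_linearMap_toMatrix_mul_basis_toMatrix _ _ _ _ T
  let D : Matrix (Fin r ⊕ Fin s) (Fin r ⊕ Fin s) ℝ := Matrix.fromBlocks B₁⁻¹ 0 0 1
  let F : Matrix (Fin r ⊕ Fin s) (Fin r ⊕ Fin s) ℝ := Matrix.fromBlocks B₁ 0 0 1
  have hB₁' : B₁⁻¹ * B₁ = 1 := Matrix.nonsing_inv_mul _ ((Matrix.isUnit_iff_isUnit_det _).1 hB₁)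
  have hA' : A⁻¹ * A = 1 := Matrix.nonsing_inv_mul _ ((Matrix.isUnit_iff_isUnit_det _).1 hA)
  have hD : D * F = 1 := by
    simp [D, F, Matrix.fromBlocks_multiply, hB₁']
  have hsub : ∀ X : Matrix (Fin n) (Fin n) ℝ,
      (((D * W' * A⁻¹).submatrix e.symm id) * X * (N'.submatrix id e.symm)).submatrix e e =
      D * (W' * (A⁻¹ * X) * N') := by
    intro X
    change ((D * W' * A⁻¹ * X * N').submatrix e.symm e.symm).submatrix e e = _
    rw [Matrix.submatrix_submatrix, Equiv.symm_comp_self, Matrix.submatrix_id_id]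
    simp only [Matrix.mul_assoc]
  refine ⟨r, s, hn, (D * W' * A⁻¹).submatrix e.symm id, N'.submatrix id e.symm, B₁⁻¹, ?_, ?_, ?_, ?_⟩
  · refine IsUnit.of_mul_eq_one ((A * N' * F).submatrix id e.symm) ?_
    change ((D * W' * A⁻¹) * (A * N' * F)).submatrix e.symm e.symm = 1
    have : (D * W' * A⁻¹) * (A * N' * F) =
        D * (W' * (A⁻¹ * A * N')) * F := by
      simp only [Matrix.mul_assoc]
    rw [this, hA', Matrix.one_mul, hWN, Matrix.mul_one, hD, Matrix.submatrix_one_equiv]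
  · refine IsUnit.of_mul_eq_one (W'.submatrix e.symm id) ?_
    rw [Matrix.submatrix_mul_equiv, hNW, Matrix.submatrix_id_id]
  · rw [hsub, hWBN, hC]
    simp [D, Matrix.fromBlocks_multiply, hB₁']
  · rw [hsub, hA', Matrix.mul_one, hWN, Matrix.mul_one]

theorem admissible_of_sectorForm {n : ℕ} {α : ℝ} (hα₂ : α < 2)
    {E A P Q : Matrix (Fin n) (Fin n) ℝ} (hP : P.PosDef)
    (hneg : ∀ u v : Fin n → ℝ, (u ≠ 0 ∨ v ≠ 0) →
      2 * sectorForm (α * Real.pi / 2) (Aᵀ * P * E) u v + u ⬝ᵥ (Aᵀ * Q * A) *ᵥ u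
        + v ⬝ᵥ (Aᵀ * Q * A) *ᵥ v < 0)
    (hQ : (Eᵀ * Q * E).PosSemidef) : Admissible E A α := by
  have hform : ∀ (R F : Matrix (Fin n) (Fin n) ℝ) (G : Matrix (Fin n) (Fin n) ℝ)
      (x y : Fin n → ℝ), x ⬝ᵥ (Gᵀ * R * F) *ᵥ y = (G *ᵥ x) ⬝ᵥ R *ᵥ (F *ᵥ y) := by
    intro R F G x y
    rw [Matrix.mul_assoc, ← Matrix.mulVec_mulVec, Matrix.dotProduct_mulVec,
      Matrix.vecMul_transpose, Matrix.mulVec_mulVec]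
  have hQ' : ∀ x : Fin n → ℝ, 0 ≤ (E *ᵥ x) ⬝ᵥ Q *ᵥ (E *ᵥ x) := fun x ↦ by
    rw [← hform]
    simpa using hQ.dotProduct_mulVec_nonneg x
  have hP' : ∀ x : Fin n → ℝ, 0 ≤ x ⬝ᵥ P *ᵥ x := fun x ↦ by
    simpa using hP.posSemidef.dotProduct_mulVec_nonneg x
  have hPsymm : ∀ x y : Fin n → ℝ, x ⬝ᵥ P *ᵥ y = y ⬝ᵥ P *ᵥ x := fun x y ↦ by
    have hPt : Pᵀ = P := by simpa using hP.isHermitian.eq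
    rw [dotProduct_comm, ← Matrix.vecMul_transpose, hPt, Matrix.dotProduct_mulVec]
  have hker : ∀ z w : Fin n → ℝ, E *ᵥ z = 0 → A *ᵥ z = E *ᵥ w → z = 0 := by
    intro z w hz hw
    by_contra h0
    have h1 := hneg z 0 (Or.inl h0)
    simp only [sectorForm, hform, hz, hw, Matrix.mulVec_zero, dotProduct_zero] at h1
    linarith [hQ' w]
  have hA : IsUnit A := by
    rw [← Matrix.mulVec_injective_iff_isUnit, ← Matrix.coe_mulVecLin, ← LinearMap.ker_eq_bot,
      LinearMap.ker_eq_bot']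
    intro z hz
    rw [Matrix.mulVecLin_apply] at hz
    by_contra h0
    have h1 := hneg z 0 (Or.inl h0)
    simp [sectorForm, hform, hz] at h1
  refine ⟨regularImpulseFree_of_disjoint hA hker, fun z hz ↦ ?_⟩
  have key : ∀ (a b : ℝ) (u v : Fin n → ℝ), (u ≠ 0 ∨ v ≠ 0) →
      A *ᵥ u = a • (E *ᵥ u) - b • (E *ᵥ v) → A *ᵥ v = a • (E *ᵥ v) + b • (E *ᵥ u) →
      Real.sin (α * Real.pi / 2) * a + Real.cos (α * Real.pi / 2) * b < 0 := by
    intro a b u v huv hu hv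
    have h1 := hneg u v huv
    have h2 : 2 * sectorForm (α * Real.pi / 2) (Aᵀ * P * E) u v + u ⬝ᵥ (Aᵀ * Q * A) *ᵥ u
        + v ⬝ᵥ (Aᵀ * Q * A) *ᵥ v =
        2 * ((Real.sin (α * Real.pi / 2) * a + Real.cos (α * Real.pi / 2) * b) *
          ((E *ᵥ u) ⬝ᵥ P *ᵥ (E *ᵥ u) + (E *ᵥ v) ⬝ᵥ P *ᵥ (E *ᵥ v))) +
        (a ^ 2 + b ^ 2) * ((E *ᵥ u) ⬝ᵥ Q *ᵥ (E *ᵥ u) + (E *ᵥ v) ⬝ᵥ Q *ᵥ (E *ᵥ v)) := by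
      simp only [sectorForm, hform, hu, hv, sub_dotProduct, add_dotProduct, smul_dotProduct,
        Matrix.mulVec_add, Matrix.mulVec_sub, Matrix.mulVec_smul, dotProduct_add, dotProduct_sub,
        dotProduct_smul, smul_eq_mul]
      rw [hPsymm (E *ᵥ v) (E *ᵥ u)]
      ring
    rw [h2] at h1
    have h3 := mul_nonneg (by positivity : 0 ≤ a ^ 2 + b ^ 2) (add_nonneg (hQ' u) (hQ' v))
    by_contra! h4
    have h5 := mul_nonneg h4 (add_nonneg (hP' (E *ᵥ u)) (hP' (E *ᵥ v)))
    linarith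
  obtain ⟨x, hx0, hx⟩ := Matrix.exists_mulVec_eq_zero_iff.2 hz
  set u : Fin n → ℝ := fun i ↦ (x i).re with hu
  set v : Fin n → ℝ := fun i ↦ (x i).im with hv
  have huv : u ≠ 0 ∨ v ≠ 0 := by
    by_contra! h
    exact hx0 (funext fun i ↦ Complex.ext (congrFun h.1 i) (congrFun h.2 i))
  have hcast : ∀ (F : Matrix (Fin n) (Fin n) ℝ) i,
      (F.map Complex.ofReal *ᵥ x) i = ⟨(F *ᵥ u) i, (F *ᵥ v) i⟩ := by
    intro F i
    apply Complex.ext <;> simp [Matrix.mulVec, dotProduct, hu, hv]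
  have hAE : ∀ i, (⟨(A *ᵥ u) i, (A *ᵥ v) i⟩ : ℂ) = z * ⟨(E *ᵥ u) i, (E *ᵥ v) i⟩ := by
    intro i
    have := congrFun hx i
    rw [Matrix.sub_mulVec, Matrix.smul_mulVec, Pi.sub_apply, Pi.smul_apply, hcast, hcast,
      Pi.zero_apply, sub_eq_zero] at this
    exact this.symm
  have hAu : A *ᵥ u = z.re • (E *ᵥ u) - z.im • (E *ᵥ v) := by
    ext i
    simpa using congrArg Complex.re (hAE i)
  have hAv : A *ᵥ v = z.re • (E *ᵥ v) + z.im • (E *ᵥ u) := by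
    ext i
    simpa using congrArg Complex.im (hAE i)
  refine sector_of_re_neg (by nlinarith [Real.pi_pos]) (key _ _ u v huv hAu hAv) ?_
  have h1 := key z.re (-z.im) u (-v) (by simpa using huv)
    (by rw [hAu, Matrix.mulVec_neg]; module)
    (by rw [Matrix.mulVec_neg, Matrix.mulVec_neg, hAv]; module)
  linarith

theorem exists_sectorForm_of_admissible {n : ℕ} {α : ℝ} (hα₁ : 1 < α) (hα₂ : α < 2)
    {E A : Matrix (Fin n) (Fin n) ℝ} (h : Admissible E A α) :
    ∃ P Q : Matrix (Fin n) (Fin n) ℝ, P.PosDef ∧ Q.IsSymm ∧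
      (∀ u v : Fin n → ℝ, (u ≠ 0 ∨ v ≠ 0) →
        2 * sectorForm (α * Real.pi / 2) (Aᵀ * P * E) u v + u ⬝ᵥ (Aᵀ * Q * A) *ᵥ u
          + v ⬝ᵥ (Aᵀ * Q * A) *ᵥ v < 0) ∧
      (Eᵀ * Q * E).PosSemidef := by
  obtain ⟨⟨r, s, hn, M, N, A₁, hM, hN, hE, hA⟩, heig⟩ := h
  set e := blockEquiv hn
  set M' : Matrix (Fin r ⊕ Fin s) (Fin n) ℝ := M.submatrix e id with hM'
  set N' : Matrix (Fin n) (Fin r ⊕ Fin s) ℝ := N.submatrix id e with hN'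
  set W : Matrix (Fin r ⊕ Fin s) (Fin n) ℝ := N⁻¹.submatrix e id with hW
  have hNW : N' * W = 1 := by
    rw [hN', hW, Matrix.submatrix_mul_equiv,
      Matrix.mul_nonsing_inv _ ((Matrix.isUnit_iff_isUnit_det _).1 hN), Matrix.submatrix_id_id]
  have hblock : ∀ X, M' * X = (M * X * N).submatrix e e * W := fun X ↦ by
    change _ = M' * X * N' * W
    rw [Matrix.mul_assoc _ N', hNW, Matrix.mul_one]
  have hME : M' * E =
      (Matrix.fromBlocks 1 0 0 0 : Matrix (Fin r ⊕ Fin s) (Fin r ⊕ Fin s) ℝ) * W := by rw [hblock, hE]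
  have hMA : M' * A =
      (Matrix.fromBlocks A₁ 0 0 1 : Matrix (Fin r ⊕ Fin s) (Fin r ⊕ Fin s) ℝ) * W := by rw [hblock, hA]
  obtain ⟨P₁, hP₁, hneg⟩ := exists_posDef_sectorForm_neg (φ := α * Real.pi / 2)
    (by nlinarith [Real.pi_pos]) (by nlinarith [Real.pi_pos]) A₁ (by
      intro z hz
      refine heig z ?_
      have h1 : (M.map Complex.ofReal * (z • E.map Complex.ofReal - A.map Complex.ofReal) *
          N.map Complex.ofReal).submatrix e e =
          Matrix.fromBlocks (z • 1 - A₁.map Complex.ofReal) 0 0 (-1) := by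
        have h2 : M.map Complex.ofReal * (z • E.map Complex.ofReal - A.map Complex.ofReal) *
            N.map Complex.ofReal =
            z • (M * E * N).map Complex.ofReal - (M * A * N).map Complex.ofReal := by
          have h3 : ∀ X : Matrix (Fin n) (Fin n) ℝ, (M * X * N).map Complex.ofReal =
              M.map Complex.ofReal * X.map Complex.ofReal * N.map Complex.ofReal := fun X ↦ by
            change (M * X * N).map Complex.ofRealHom = _
            rw [Matrix.map_mul, Matrix.map_mul]
            rfl
          rw [h3, h3, Matrix.mul_sub, Matrix.sub_mul, Matrix.mul_smul, Matrix.smul_mul]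
        rw [h2]
        change z • ((M * E * N).submatrix e e).map Complex.ofReal -
          ((M * A * N).submatrix e e).map Complex.ofReal = _
        rw [hE, hA]
        ext i j
        rcases i with i | i <;> rcases j with j | j <;>
          simp [Matrix.fromBlocks, Matrix.one_apply, apply_ite]
      have h4 := congrArg Matrix.det h1
      rw [Matrix.det_submatrix_equiv_self, Matrix.det_fromBlocks_zero₂₁, hz, zero_mul,
        Matrix.det_mul, Matrix.det_mul] at h4
      have hdet : ∀ X : Matrix (Fin n) (Fin n) ℝ, IsUnit X → (X.map Complex.ofReal).det ≠ 0 := by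
        intro X hX h0
        have h5 : ((X.det : ℝ) : ℂ) = (X.map Complex.ofReal).det := Complex.ofRealHom.map_det X
        rw [h0, Complex.ofReal_eq_zero] at h5
        exact ((Matrix.isUnit_iff_isUnit_det _).1 hX).ne_zero h5
      simpa [hdet M hM, hdet N hN] using h4)
  set P' : Matrix (Fin r ⊕ Fin s) (Fin r ⊕ Fin s) ℝ := Matrix.fromBlocks P₁ 0 0 1 with hP'
  set Q' : Matrix (Fin r ⊕ Fin s) (Fin r ⊕ Fin s) ℝ := Matrix.fromBlocks 0 0 0 (-1) with hQ'
  have hP'def : P'.PosDef := by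
    rw [Matrix.posDef_iff_dotProduct_mulVec]
    refine ⟨Matrix.IsHermitian.fromBlocks hP₁.isHermitian (by simp) Matrix.isHermitian_one, ?_⟩
    intro x hx
    rw [star_trivial, ← Sum.elim_comp_inl_inr x, hP', Matrix.fromBlocks_mulVec,
      sumElim_dotProduct_sumElim]
    simp only [Sum.elim_comp_inl, Sum.elim_comp_inr, Matrix.zero_mulVec, add_zero, zero_add,
      Matrix.one_mulVec]
    have h1 := hP₁.posSemidef.dotProduct_mulVec_nonneg (x ∘ Sum.inl)
    have h2 : 0 ≤ (x ∘ Sum.inr) ⬝ᵥ (x ∘ Sum.inr) := Finset.sum_nonneg fun _ _ ↦ mul_self_nonneg _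
    rw [star_trivial] at h1
    by_cases h3 : x ∘ Sum.inl = 0
    · have h4 : x ∘ Sum.inr ≠ 0 := fun h4 ↦ hx (funext fun i ↦ by
        rcases i with i | i
        · exact congrFun h3 i
        · exact congrFun h4 i)
      have h5 := (dotProduct_self_eq_zero (v := x ∘ Sum.inr)).not.2 h4
      have := lt_of_le_of_ne h2 (Ne.symm h5)
      linarith
    · have := hP₁.dotProduct_mulVec_pos h3
      rw [star_trivial] at this
      linarith
  have hM'inj : Function.Injective M'.mulVec := by
    intro x y hxy
    refine Matrix.mulVec_injective_of_isUnit hM (funext fun i ↦ ?_)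
    simpa [hM', Matrix.mulVec, dotProduct] using congrFun hxy (e.symm i)
  have hcongr : ∀ (R : Matrix (Fin r ⊕ Fin s) (Fin r ⊕ Fin s) ℝ) (F G : Matrix (Fin n) (Fin n) ℝ)
      (F' G' : Matrix (Fin r ⊕ Fin s) (Fin r ⊕ Fin s) ℝ),
      M' * F = F' * W → M' * G = G' * W →
      Gᵀ * (M'ᵀ * R * M') * F = Wᵀ * (G'ᵀ * R * F') * W := by
    intro R F G F' G' hF hG
    calc Gᵀ * (M'ᵀ * R * M') * F = (M' * G)ᵀ * R * (M' * F) := by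
          simp only [Matrix.transpose_mul, Matrix.mul_assoc]
      _ = _ := by
          rw [hF, hG]
          simp only [Matrix.transpose_mul, Matrix.mul_assoc]
  have hWform : ∀ (R : Matrix (Fin r ⊕ Fin s) (Fin r ⊕ Fin s) ℝ) (x y : Fin n → ℝ),
      x ⬝ᵥ (Wᵀ * R * W) *ᵥ y = (W *ᵥ x) ⬝ᵥ R *ᵥ (W *ᵥ y) := by
    intro R x y
    rw [Matrix.mul_assoc, ← Matrix.mulVec_mulVec, Matrix.dotProduct_mulVec,
      Matrix.vecMul_transpose, Matrix.mulVec_mulVec]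
  have hWinj : ∀ x, W *ᵥ x = 0 → x = 0 := fun x hx ↦ by
    rw [← Matrix.one_mulVec x, ← hNW, ← Matrix.mulVec_mulVec, hx, Matrix.mulVec_zero]
  refine ⟨M'ᵀ * P' * M', M'ᵀ * Q' * M', ?_, ?_, ?_, ?_⟩
  · simpa using hP'def.conjTranspose_mul_mul_same hM'inj
  · rw [Matrix.IsSymm]
    simp [hQ', Matrix.transpose_mul, Matrix.mul_assoc, Matrix.fromBlocks_transpose]
  · intro u v huv
    simp only [hcongr _ _ _ _ _ hME hMA, hcongr _ _ _ _ _ hMA hMA, sectorForm, hWform]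
    have huv' : W *ᵥ u ≠ 0 ∨ W *ᵥ v ≠ 0 :=
      huv.imp (fun h h0 ↦ h (hWinj _ h0)) (fun h h0 ↦ h (hWinj _ h0))
    generalize W *ᵥ u = x at huv' ⊢
    generalize W *ᵥ v = y at huv' ⊢
    obtain ⟨x₁, x₂, rfl⟩ : ∃ x₁ x₂, x = Sum.elim x₁ x₂ := ⟨_, _, (Sum.elim_comp_inl_inr x).symm⟩
    obtain ⟨y₁, y₂, rfl⟩ : ∃ y₁ y₂, y = Sum.elim y₁ y₂ := ⟨_, _, (Sum.elim_comp_inl_inr y).symm⟩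
    simp only [hP', hQ', Matrix.fromBlocks_transpose, Matrix.fromBlocks_multiply,
      Matrix.fromBlocks_mulVec, sumElim_dotProduct_sumElim, Sum.elim_comp_inl,
      Sum.elim_comp_inr]
    simp [Matrix.neg_mulVec]
    have h1 : 0 ≤ x₂ ⬝ᵥ x₂ := Finset.sum_nonneg fun _ _ ↦ mul_self_nonneg _
    have h2 : 0 ≤ y₂ ⬝ᵥ y₂ := Finset.sum_nonneg fun _ _ ↦ mul_self_nonneg _
    by_cases h3 : x₁ ≠ 0 ∨ y₁ ≠ 0
    · have := hneg x₁ y₁ h3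
      rw [sectorForm] at this
      linarith
    · push Not at h3
      obtain ⟨rfl, rfl⟩ := h3
      have h4 : x₂ ≠ 0 ∨ y₂ ≠ 0 := by
        by_contra! h4
        obtain ⟨rfl, rfl⟩ := h4
        simp at huv'
      simp
      rcases h4 with h4 | h4
      · have := lt_of_le_of_ne h1 (Ne.symm ((dotProduct_self_eq_zero (v := x₂)).not.2 h4))
        linarith
      · have := lt_of_le_of_ne h2 (Ne.symm ((dotProduct_self_eq_zero (v := y₂)).not.2 h4))
        linarith
  · rw [hcongr _ _ _ _ _ hME hME]
    simp [hQ', Matrix.fromBlocks_transpose, Matrix.fromBlocks_multiply, Matrix.PosSemidef.zero]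

/-- `(E, A, α)` with `1 < α < 2` is admissible iff there exist `P = Pᵀ > 0`
and `Q = Qᵀ` with `Sym{Θ⊗(AᵀPE)} + I₂⊗(AᵀQA) < 0` and `EᵀQE ≥ 0`. -/
theorem stmt_7 {n : ℕ} (α : ℝ) (hα₁ : 1 < α) (hα₂ : α < 2)
    (E A : Matrix (Fin n) (Fin n) ℝ) :
    Admissible E A α ↔
    ∃ P Q : Matrix (Fin n) (Fin n) ℝ, P.PosDef ∧ Q.IsSymm ∧
      NegDef (matSym (Θmat α ⊗ₖ (Aᵀ * P * E)) +
        (1 : Matrix (Fin 2) (Fin 2) ℝ) ⊗ₖ (Aᵀ * Q * A)) ∧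
      (Eᵀ * Q * E).PosSemidef := by
  have hsymm : ∀ Q : Matrix (Fin n) (Fin n) ℝ, Q.IsSymm → (Aᵀ * Q * A).IsSymm := fun Q hQ ↦ by
    rw [Matrix.IsSymm, Matrix.transpose_mul, Matrix.transpose_mul, hQ, Matrix.transpose_transpose,
      Matrix.mul_assoc]
  constructor
  · intro h
    obtain ⟨P, Q, hP, hQ, hneg, hsemi⟩ := exists_sectorForm_of_admissible hα₁ hα₂ h
    exact ⟨P, Q, hP, hQ, (negDef_iff_sectorForm α _ _ (hsymm Q hQ)).2 hneg, hsemi⟩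
  · rintro ⟨P, Q, hP, hQ, hneg, hsemi⟩
    exact admissible_of_sectorForm hα₂ hP
      ((negDef_iff_sectorForm α _ _ (hsymm Q hQ)).1 hneg) hsemi
end

section
/- Let 1 < α < 2 and E, A ∈ ℝ^{n×n} with rank E = r, and let E₀ ∈ ℝ^{n×(n−r)} have full column rank with EᵀE₀ = 0. The triplet (E, A, α) is admissible if and only if there exist a symmetric positive definite matrix P ∈ ℝ^{n×n} and a matrix Q ∈ ℝ^{(n−r)×n} such that Sym{Θ⊗(EᵀPA) + I₂⊗(QᵀE₀ᵀA)} is negative definite, where Θ = [[sin(απ/2), −cos(απ/2)], [cos(απ/2), sin(απ/2)]]. -/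
open Matrix Kronecker

/-- The Hermitian form `v* X v` of a real matrix at a complex vector. -/
noncomputable def complexForm {m : Type*} [Fintype m] (X : Matrix m m ℝ) (v : m → ℂ) : ℂ :=
  star v ⬝ᵥ (X.map Complex.ofReal *ᵥ v)

section ComplexForm

variable {m : Type*} [Fintype m]

lemma complexForm_eq_sum (X : Matrix m m ℝ) (v : m → ℂ) :
    complexForm X v = ∑ i, ∑ j, star (v i) * (X i j * v j) := by
  simp [complexForm, dotProduct, mulVec, Finset.mul_sum]

lemma map_ofReal_mul (X Y : Matrix m m ℝ) :
    (X * Y).map Complex.ofReal = X.map Complex.ofReal * Y.map Complex.ofReal :=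
  Matrix.map_mul (f := Complex.ofRealHom)

lemma complexForm_transpose_mul_mul (X B : Matrix m m ℝ) (v : m → ℂ) :
    complexForm (Bᵀ * X * B) v = complexForm X (B.map Complex.ofReal *ᵥ v) := by
  have h : (Bᵀ).map Complex.ofReal = (B.map Complex.ofReal)ᴴ := by
    ext i j; simp
  simp only [complexForm, map_ofReal_mul, h, ← mulVec_mulVec]
  rw [dotProduct_mulVec, star_mulVec]

lemma complexForm_neg (X : Matrix m m ℝ) (v : m → ℂ) :
    complexForm (-X) v = -complexForm X v := by
  simp [complexForm_eq_sum]

lemma complexForm_one_re [DecidableEq m] (v : m → ℂ) :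
    (complexForm 1 v).re = ∑ i, Complex.normSq (v i) := by
  have : complexForm 1 v = star v ⬝ᵥ v := by
    rw [complexForm, Matrix.map_one _ Complex.ofReal_zero Complex.ofReal_one, one_mulVec]
  rw [this, dotProduct, Complex.re_sum]
  refine Finset.sum_congr rfl fun i _ => ?_
  simp [Complex.normSq_apply]

lemma complexForm_one_re_nonneg [DecidableEq m] (v : m → ℂ) : 0 ≤ (complexForm 1 v).re := by
  rw [complexForm_one_re]
  exact Finset.sum_nonneg fun i _ => Complex.normSq_nonneg _

lemma complexForm_one_re_pos [DecidableEq m] {v : m → ℂ} (hv : v ≠ 0) :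
    0 < (complexForm 1 v).re := by
  rw [complexForm_one_re]
  obtain ⟨i, hi⟩ := Function.ne_iff.mp hv
  exact Finset.sum_pos' (fun i _ => Complex.normSq_nonneg _)
    ⟨i, Finset.mem_univ _, Complex.normSq_pos.mpr hi⟩

lemma Matrix.PosDef.complexForm_eq {P : Matrix m m ℝ} (hP : P.PosDef) (v : m → ℂ) :
    ∃ q : ℝ, 0 ≤ q ∧ complexForm P v = q := by
  set a : m → ℝ := fun i => (v i).re
  set b : m → ℝ := fun i => (v i).im
  refine ⟨a ⬝ᵥ (P *ᵥ a) + b ⬝ᵥ (P *ᵥ b), add_nonneg ?_ ?_, ?_⟩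
  · simpa using hP.posSemidef.dotProduct_mulVec_nonneg a
  · simpa using hP.posSemidef.dotProduct_mulVec_nonneg b
  have hs : ∀ i j, P i j = P j i := fun i j => by
    simpa using congrFun (congrFun hP.isHermitian j) i
  have him : ∑ i, ∑ j, (a i * (P i j * b j)) = ∑ i, ∑ j, (b i * (P i j * a j)) := by
    rw [Finset.sum_comm]
    refine Finset.sum_congr rfl fun i _ => Finset.sum_congr rfl fun j _ => ?_
    rw [hs]; ring
  apply Complex.ext
  · simp only [complexForm_eq_sum, Complex.re_sum, Complex.ofReal_re, dotProduct, mulVec,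
      Finset.mul_sum, ← Finset.sum_add_distrib]
    refine Finset.sum_congr rfl fun i _ => Finset.sum_congr rfl fun j _ => ?_
    simp [a, b]
  · simp only [complexForm_eq_sum, Complex.im_sum, Complex.ofReal_im]
    rw [← sub_eq_zero.mpr him]
    simp only [← Finset.sum_sub_distrib]
    refine Finset.sum_congr rfl fun i _ => Finset.sum_congr rfl fun j _ => ?_
    simp [a, b]; ring

lemma dotProduct_matSym (M : Matrix m m ℝ) (x : m → ℝ) :
    x ⬝ᵥ (matSym M *ᵥ x) = 2 * (x ⬝ᵥ (M *ᵥ x)) := by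
  rw [matSym, add_mulVec, dotProduct_add, mulVec_transpose, dotProduct_comm x (x ᵥ* M),
    ← dotProduct_mulVec]
  ring

lemma negDef_matSym_iff (M : Matrix m m ℝ) :
    NegDef (matSym M) ↔ ∀ x, x ≠ 0 → x ⬝ᵥ (M *ᵥ x) < 0 := by
  have hh : (-matSym M).IsHermitian := by
    simp [IsHermitian, matSym, conjTranspose_eq_transpose_of_trivial, add_comm]
  simp only [NegDef, posDef_iff_dotProduct_mulVec, hh, true_and, star_trivial, neg_mulVec,
    dotProduct_neg, dotProduct_matSym, Left.neg_pos_iff]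
  exact forall_congr' fun x => imp_congr_right fun _ => ⟨fun h => by linarith, fun h => by linarith⟩

/-- The complex number `sin(απ/2) + i cos(απ/2)`. -/
noncomputable def sectorRotation (α : ℝ) : ℂ :=
  ⟨Real.sin (α * Real.pi / 2), Real.cos (α * Real.pi / 2)⟩

lemma dotProduct_kronecker_mulVec_s8 (α : ℝ) (Y Z : Matrix m m ℝ) (x : Fin 2 × m → ℝ) :
    x ⬝ᵥ ((Θmat α ⊗ₖ Y + (1 : Matrix (Fin 2) (Fin 2) ℝ) ⊗ₖ Z) *ᵥ x) =
      (sectorRotation α * complexForm Y (fun i => ⟨x (0, i), x (1, i)⟩) +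
        complexForm Z (fun i => ⟨x (0, i), x (1, i)⟩)).re := by
  simp only [dotProduct, mulVec, Fintype.sum_prod_type, Fin.sum_univ_two, complexForm_eq_sum,
    Finset.mul_sum, ← Finset.sum_add_distrib, Complex.re_sum, mul_add]
  refine Finset.sum_congr rfl fun i _ => Finset.sum_congr rfl fun j _ => ?_
  simp [Θmat, sectorRotation, kroneckerMap_apply]
  ring

/-- The Kronecker matrix inequality as a condition on complex vectors. -/
lemma negDef_kronecker_iff (α : ℝ) (Y Z : Matrix m m ℝ) :
    NegDef (matSym (Θmat α ⊗ₖ Y + (1 : Matrix (Fin 2) (Fin 2) ℝ) ⊗ₖ Z)) ↔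
      ∀ v : m → ℂ, v ≠ 0 →
        (sectorRotation α * complexForm Y v + complexForm Z v).re < 0 := by
  rw [negDef_matSym_iff]
  constructor
  · intro h v hv
    have h1 := h (fun p => if p.1 = 0 then (v p.2).re else (v p.2).im) ?_
    · rw [dotProduct_kronecker_mulVec_s8] at h1
      simpa using h1
    · intro h0
      apply hv
      ext i
      apply Complex.ext
      · simpa using congrFun h0 (0, i)
      · simpa using congrFun h0 (1, i)
  · intro h x hx
    rw [dotProduct_kronecker_mulVec_s8]
    refine h _ fun h0 => hx ?_
    ext ⟨k, i⟩
    have h1 := congrFun h0 i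
    fin_cases k
    · simpa using congrArg Complex.re h1
    · simpa using congrArg Complex.im h1

end ComplexForm

/-- The sector `|arg μ| > απ/2` is the intersection of two half-planes. -/
lemma lt_abs_arg_iff {α : ℝ} (hα₁ : 1 < α) (hα₂ : α < 2) (μ : ℂ) :
    α * Real.pi / 2 < |μ.arg| ↔
      (sectorRotation α * μ).re < 0 ∧ (star (sectorRotation α) * μ).re < 0 := by
  have hpi := Real.pi_pos
  set θ := α * Real.pi / 2 with hθ
  have h0 : Real.pi / 2 < θ := by rw [hθ]; nlinarith
  have h1 : 0 < θ := by positivity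
  have h2 : θ < Real.pi := by rw [hθ]; nlinarith
  have hle := Complex.arg_le_pi μ
  have hgt := Complex.neg_pi_lt_arg μ
  have e1 : (sectorRotation α * μ).re = ‖μ‖ * Real.sin (θ - μ.arg) := by
    rw [Real.sin_sub, Complex.mul_re]
    simp only [sectorRotation, ← hθ]
    rw [← Complex.norm_mul_cos_arg μ, ← Complex.norm_mul_sin_arg μ]
    simp only [Complex.norm_mul_cos_arg, Complex.norm_mul_sin_arg]
    rw [mul_sub, mul_left_comm, Complex.norm_mul_cos_arg, mul_left_comm, Complex.norm_mul_sin_arg]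
  have e2 : (star (sectorRotation α) * μ).re = ‖μ‖ * Real.sin (θ + μ.arg) := by
    rw [Real.sin_add, Complex.mul_re, mul_add, mul_left_comm, Complex.norm_mul_cos_arg,
      mul_left_comm, Complex.norm_mul_sin_arg]
    simp [sectorRotation, hθ]
  rw [e1, e2]
  constructor
  · intro h
    have h0 : 0 < ‖μ‖ := by
      rw [norm_pos_iff]
      rintro rfl
      simp at h
      linarith
    rcases lt_abs.mp h with h | h
    · refine ⟨mul_neg_of_pos_of_neg h0 (Real.sin_neg_of_neg_of_neg_pi_lt (by linarith)
        (by linarith)), mul_neg_of_pos_of_neg h0 ?_⟩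
      rw [← Real.sin_sub_two_pi]
      exact Real.sin_neg_of_neg_of_neg_pi_lt (by linarith) (by linarith)
    · refine ⟨mul_neg_of_pos_of_neg h0 ?_, mul_neg_of_pos_of_neg h0
        (Real.sin_neg_of_neg_of_neg_pi_lt (by linarith) (by linarith))⟩
      rw [← Real.sin_sub_two_pi]
      exact Real.sin_neg_of_neg_of_neg_pi_lt (by linarith) (by linarith)
  · rintro ⟨h3, h4⟩
    by_contra! h
    obtain ⟨h5, h6⟩ := abs_le.mp h
    have hn := norm_nonneg μ
    rcases le_total 0 μ.arg with h7 | h7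
    · exact absurd h3 (not_lt.mpr (mul_nonneg hn
        (Real.sin_nonneg_of_nonneg_of_le_pi (by linarith) (by linarith))))
    · exact absurd h4 (not_lt.mpr (mul_nonneg hn
        (Real.sin_nonneg_of_nonneg_of_le_pi (by linarith) (by linarith))))

/-- If the spectrum of `f` lies in the open half-planes `Re (w μ) < 0` and `Re (w̄ μ) < 0`, some
inner product makes `f` strictly dissipative in both directions at once. -/
lemma exists_common_dissipative (w : ℂ) (d : ℕ) :
    ∀ (V : Type) [AddCommGroup V] [Module ℂ V] [FiniteDimensional ℂ V] (f : V →ₗ[ℂ] V),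
      Module.finrank ℂ V = d →
      (∀ (μ : ℂ) (v : V), v ≠ 0 → f v = μ • v → (w * μ).re < 0 ∧ (star w * μ).re < 0) →
      ∃ (F : Type) (_ : NormedAddCommGroup F) (_ : InnerProductSpace ℂ F) (T : V →ₗ[ℂ] F)
        (c : ℝ), 0 < c ∧ Function.Injective T ∧ ∀ v,
          (w * inner ℂ (T v) (T (f v))).re ≤ -c * ‖T v‖ ^ 2 ∧
          (star w * inner ℂ (T v) (T (f v))).re ≤ -c * ‖T v‖ ^ 2 := by
  induction d with
  | zero =>
    intro V _ _ _ f hd _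
    have := Module.finrank_zero_iff.mp hd
    exact ⟨ℂ, inferInstance, inferInstance, 0, 1, one_pos, Function.injective_of_subsingleton _,
      by simp⟩
  | succ d ih =>
    intro V _ _ _ f hd hf
    have : Nontrivial V := Module.nontrivial_of_finrank_pos (R := ℂ) (by omega)
    obtain ⟨l, hl⟩ := Module.End.exists_eigenvalue (K := ℂ) (V := Module.Dual ℂ V) f.dualMap
    obtain ⟨φ, hφ⟩ := hl.exists_hasEigenvector
    have hφf : ∀ v, φ (f v) = l * φ v := fun v => by
      simpa using LinearMap.congr_fun hφ.apply_eq_smul v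
    obtain ⟨e', he'⟩ : ∃ e : V, φ e ≠ 0 := by
      by_contra! h
      exact hφ.2 (LinearMap.ext h)
    obtain ⟨e, he⟩ : ∃ e : V, φ e = 1 := ⟨(φ e')⁻¹ • e', by simp [he']⟩
    obtain ⟨u, hu0, hu⟩ : ∃ u : V, u ≠ 0 ∧ f u = l • u := by
      have hns : ¬ Function.Surjective (f - l • (LinearMap.id : V →ₗ[ℂ] V)) := by
        intro hs
        obtain ⟨y, hy⟩ := hs e
        have : φ e = 0 := by
          rw [← hy]; simp [hφf]
        simp [he] at this
      rw [← LinearMap.injective_iff_surjective, injective_iff_map_eq_zero] at hns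
      push Not at hns
      obtain ⟨u, h1, h2⟩ := hns
      exact ⟨u, h2, by simpa [sub_eq_zero] using h1⟩
    obtain ⟨hl1, hl2⟩ := hf l u hu0 hu
    have hmem : ∀ v ∈ LinearMap.ker φ, f v ∈ LinearMap.ker φ := fun v hv => by
      simp only [LinearMap.mem_ker] at hv ⊢
      rw [hφf, hv, mul_zero]
    have hdim : Module.finrank ℂ (LinearMap.ker φ) = d := by
      have h1 := LinearMap.finrank_range_add_finrank_ker φ
      have h2 : LinearMap.range φ = ⊤ := LinearMap.range_eq_top.mpr fun z => ⟨z • e, by simp [he]⟩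
      rw [h2, finrank_top, Module.finrank_self] at h1
      omega
    obtain ⟨F, _, _, T, c, hc, hT, hTc⟩ := ih (LinearMap.ker φ) (f.restrict hmem) hdim
      fun μ v hv hμ => hf μ v (by simpa using hv) (by simpa using congrArg Subtype.val hμ)
    obtain ⟨p, hp⟩ : ∃ p : V →ₗ[ℂ] LinearMap.ker φ, ∀ v, (p v : V) = v - φ v • e :=
      ⟨(LinearMap.id - φ.smulRight e).codRestrict _ fun v => by simp [he], fun v => rfl⟩
    obtain ⟨g, hg⟩ : ∃ g : LinearMap.ker φ, (g : V) = f e - l • e :=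
      ⟨⟨f e - l • e, by simp [hφf, he]⟩, rfl⟩
    have hpf : ∀ v, p (f v) = f.restrict hmem (p v) + φ v • g := fun v => by
      ext
      simp only [hp, hg, hφf, Submodule.coe_add, Submodule.coe_smul, LinearMap.coe_restrict_apply,
        map_sub, map_smul, smul_sub, smul_smul, mul_comm l]
      abel
    set D := ‖w‖ * ‖T g‖ with hD
    have hD0 : 0 ≤ D := by positivity
    obtain ⟨δ, hδ, hδ1, hδ2⟩ : ∃ δ > 0, (w * l).re ≤ -δ ∧ (star w * l).re ≤ -δ :=
      ⟨min (-(w * l).re) (-(star w * l).re), lt_min (by linarith) (by linarith),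
        by linarith [min_le_left (-(w * l).re) (-(star w * l).re)],
        by linarith [min_le_right (-(w * l).re) (-(star w * l).re)]⟩
    obtain ⟨k, hk0, hk⟩ : ∃ k : ℝ, 0 < k ∧ D ^ 2 ≤ c * δ * k ^ 2 := by
      refine ⟨D ^ 2 / (c * δ) + 1, by positivity, ?_⟩
      have h0 : 0 ≤ D ^ 2 / (c * δ) := by positivity
      have h1 : c * δ * (D ^ 2 / (c * δ)) = D ^ 2 := by field_simp
      nlinarith [mul_pos hc hδ]
    let S : V →ₗ[ℂ] WithLp 2 (F × ℂ) :=
      (WithLp.linearEquiv 2 ℂ (F × ℂ)).symm.toLinearMap ∘ₗ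
        ((T ∘ₗ p).prod ((k : ℂ) • φ))
    have hS1 : ∀ v, (S v).fst = T (p v) := fun v => rfl
    have hS2 : ∀ v, (S v).snd = k * φ v := fun v => rfl
    have hSn : ∀ v, ‖S v‖ ^ 2 = ‖T (p v)‖ ^ 2 + k ^ 2 * ‖φ v‖ ^ 2 := fun v => by
      rw [WithLp.prod_norm_sq_eq_of_L2, hS1, hS2, norm_mul, mul_pow, Complex.norm_real,
        Real.norm_eq_abs, sq_abs]
    have hSi : ∀ v, inner ℂ (S v) (S (f v)) = inner ℂ (T (p v)) (T (f.restrict hmem (p v))) +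
        φ v * inner ℂ (T (p v)) (T g) + k ^ 2 * ‖φ v‖ ^ 2 * l := fun v => by
      change inner ℂ (T (p v)) (T (p (f v))) + inner ℂ (k * φ v) (k * φ (f v)) = _
      rw [hpf, map_add, map_smul, inner_add_right,
        inner_smul_right, hφf, ← Complex.conj_mul']
      simp
      ring
    refine ⟨WithLp 2 (F × ℂ), inferInstance, inferInstance, S, min (c / 2) (δ / 2),
      lt_min (by linarith) (by linarith), ?_, ?_⟩
    · rw [injective_iff_map_eq_zero]
      intro v hv
      have h1 : T (p v) = 0 := by rw [← hS1, hv]; rfl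
      have h2 : (k : ℂ) * φ v = 0 := by rw [← hS2, hv]; rfl
      have h3 : φ v = 0 := by
        rcases mul_eq_zero.mp h2 with h | h
        · exact absurd (Complex.ofReal_eq_zero.mp h) hk0.ne'
        · exact h
      have h4 := congrArg Subtype.val ((map_eq_zero_iff T hT).mp h1)
      simpa [hp, h3] using h4
    · have key : ∀ z : ℂ, ‖z‖ = ‖w‖ → (z * l).re ≤ -δ → ∀ v,
          (z * inner ℂ (T (p v)) (T (f.restrict hmem (p v)))).re ≤ -c * ‖T (p v)‖ ^ 2 →
          (z * inner ℂ (S v) (S (f v))).re ≤ -min (c / 2) (δ / 2) * ‖S v‖ ^ 2 := by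
        intro z hz hzl v hv
        rw [hSi, hSn, mul_add, mul_add, Complex.add_re, Complex.add_re]
        have h1 : (z * (φ v * inner ℂ (T (p v)) (T g))).re ≤ D * ‖T (p v)‖ * ‖φ v‖ := by
          refine (Complex.re_le_norm _).trans ?_
          rw [norm_mul, norm_mul, hz]
          have := norm_inner_le_norm (𝕜 := ℂ) (T (p v)) (T g)
          calc ‖w‖ * (‖φ v‖ * ‖inner ℂ (T (p v)) (T g)‖)
              ≤ ‖w‖ * (‖φ v‖ * (‖T (p v)‖ * ‖T g‖)) := by gcongr
            _ = D * ‖T (p v)‖ * ‖φ v‖ := by rw [hD]; ring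
        have h2 : (z * (k ^ 2 * ‖φ v‖ ^ 2 * l)).re = k ^ 2 * ‖φ v‖ ^ 2 * (z * l).re := by
          rw [← Complex.re_ofReal_mul]
          congr 1
          push_cast
          ring
        rw [h2]
        set a := ‖T (p v)‖
        set b := ‖φ v‖
        have h3 : k ^ 2 * b ^ 2 * (z * l).re ≤ k ^ 2 * b ^ 2 * (-δ) := by gcongr
        have h4 : min (c / 2) (δ / 2) * (a ^ 2 + k ^ 2 * b ^ 2) ≤
            c / 2 * a ^ 2 + δ / 2 * (k ^ 2 * b ^ 2) := by
          rw [mul_add]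
          gcongr
          · exact min_le_left _ _
          · exact min_le_right _ _
        have h5 : D * a * b ≤ c / 2 * a ^ 2 + δ / 2 * (k ^ 2 * b ^ 2) := by
          have h6 : 0 ≤ (c * a - D * b) ^ 2 := sq_nonneg _
          have h7 : D ^ 2 * b ^ 2 ≤ c * δ * k ^ 2 * b ^ 2 := by gcongr
          have h8 : 0 ≤ c * (c / 2 * a ^ 2 + δ / 2 * (k ^ 2 * b ^ 2) - D * a * b) := by nlinarith
          linarith [nonneg_of_mul_nonneg_right h8 hc]
        linarith
      exact fun v => ⟨key w rfl hδ1 v (hTc (p v)).1, key (star w) (norm_star w) hδ2 v (hTc (p v)).2⟩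

/-- A real matrix with spectrum in a symmetric sector admits a real Lyapunov matrix. -/
lemma exists_posDef_complexForm_neg {n : ℕ} (w : ℂ) (B : Matrix (Fin n) (Fin n) ℝ)
    (hB : ∀ (μ : ℂ) (v : Fin n → ℂ), v ≠ 0 → B.map Complex.ofReal *ᵥ v = μ • v →
      (w * μ).re < 0 ∧ (star w * μ).re < 0) :
    ∃ P : Matrix (Fin n) (Fin n) ℝ, P.PosDef ∧
      ∀ v : Fin n → ℂ, v ≠ 0 → (w * complexForm (P * B) v).re < 0 := by
  obtain ⟨F, _, _, T, c, hc, hT, hTc⟩ := exists_common_dissipative w n (Fin n → ℂ)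
    (Matrix.toLin' (B.map Complex.ofReal)) (by simp) (by simpa using hB)
  have hTpos : ∀ v, v ≠ 0 → 0 < ‖T v‖ ^ 2 := fun v hv => by
    have : T v ≠ 0 := (map_ne_zero_iff T hT).mpr hv
    positivity
  let G : Matrix (Fin n) (Fin n) ℂ := fun i j => inner ℂ (T (Pi.single i 1)) (T (Pi.single j 1))
  have hTsum : ∀ v : Fin n → ℂ, T v = ∑ i, v i • T (Pi.single i 1) := fun v => by
    conv_lhs => rw [pi_eq_sum_univ' v]
    simp [map_sum]
  have hG : ∀ v u : Fin n → ℂ, inner ℂ (T v) (T u) = ∑ i, ∑ j, star (v i) * (G i j * u j) := by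
    intro v u
    rw [hTsum v, hTsum u, sum_inner]
    refine Finset.sum_congr rfl fun i _ => ?_
    rw [inner_sum]
    refine Finset.sum_congr rfl fun j _ => ?_
    rw [inner_smul_left, inner_smul_right]
    simp [G, mul_comm]
  let P : Matrix (Fin n) (Fin n) ℝ := fun i j => (G i j).re
  have hP : ∀ v u : Fin n → ℂ, star v ⬝ᵥ (P.map Complex.ofReal *ᵥ u) =
      (inner ℂ (T v) (T u) + star (inner ℂ (T (star v)) (T (star u)))) / 2 := by
    intro v u
    rw [hG, hG, eq_div_iff two_ne_zero]
    simp only [dotProduct, mulVec, Finset.mul_sum, Finset.sum_mul, star_sum,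
      ← Finset.sum_add_distrib]
    refine Finset.sum_congr rfl fun i _ => Finset.sum_congr rfl fun j _ => ?_
    have h1 : ((P i j : ℝ) : ℂ) * 2 = G i j + star (G i j) := by
      simp [P, Complex.add_conj, mul_comm]
    calc star (v i) * ((P i j : ℂ) * u j) * 2 = star (v i) * ((P i j : ℂ) * 2) * u j := by ring
      _ = _ := by rw [h1]; simp; ring
  refine ⟨P, posDef_iff_dotProduct_mulVec.mpr ⟨?_, fun x hx => ?_⟩, fun v hv => ?_⟩
  · ext i j
    exact inner_re_symm (𝕜 := ℂ) _ _
  · set v : Fin n → ℂ := fun i => (x i : ℂ) with hv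
    have hv0 : v ≠ 0 := fun h => hx (funext fun i => by simpa [hv] using congrFun h i)
    have hsv : star v = v := by ext i; simp [hv]
    have h1 := hP v v
    rw [hsv, inner_self_eq_norm_sq_to_K] at h1
    have h2 : (star x ⬝ᵥ (P *ᵥ x) : ℝ) = ((‖T v‖ ^ 2 : ℝ) : ℂ) := by
      have : ((star x ⬝ᵥ (P *ᵥ x) : ℝ) : ℂ) = v ⬝ᵥ (P.map Complex.ofReal *ᵥ v) := by
        simp [dotProduct, mulVec, hv]
      rw [this, h1]
      simp
    rw [Complex.ofReal_inj.mp h2]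
    exact hTpos v hv0
  · have hsB : star (B.map Complex.ofReal *ᵥ v) = B.map Complex.ofReal *ᵥ star v := by
      ext i
      simp [mulVec, dotProduct]
    have h1 := (hTc v).1
    have h2 := (hTc (star v)).2
    rw [Matrix.toLin'_apply] at h1 h2
    rw [complexForm, map_ofReal_mul, ← mulVec_mulVec, hP, hsB]
    have h3 : (w * star (inner ℂ (T (star v)) (T (B.map Complex.ofReal *ᵥ star v)))).re =
        (star w * inner ℂ (T (star v)) (T (B.map Complex.ofReal *ᵥ star v))).re := by
      simp only [Complex.mul_re, Complex.star_def, Complex.conj_re, Complex.conj_im]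
      ring
    have h4 : ∀ z : ℂ, (w * (z / 2)).re = (w * z).re / 2 := fun z => by
      rw [← mul_div_assoc]; simp
    rw [h4, mul_add, Complex.add_re, h3]
    have h5 := mul_pos hc (hTpos v hv)
    have h6 := mul_nonneg hc.le (sq_nonneg ‖T (star v)‖)
    linarith

/-- Bases adapted to a pair of maps `f, g` such that `g` sends `ker f` to a complement of
`range f`. -/
lemma exists_bases_of_ker {V : Type*} [AddCommGroup V] [Module ℝ V] [FiniteDimensional ℝ V]
    (f g : V →ₗ[ℝ] V) (hfg : ∀ x y, f x = 0 → g x = f y → x = 0) :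
    ∃ (k l : ℕ) (b c : Module.Basis (Fin k ⊕ Fin l) ℝ V),
      (∀ i, f (b (Sum.inl i)) = c (Sum.inl i)) ∧ (∀ i, f (b (Sum.inr i)) = 0) ∧
      (∀ i, g (b (Sum.inr i)) = c (Sum.inr i)) ∧
      ∀ i j, c.repr (g (b (Sum.inl i))) (Sum.inr j) = 0 := by
  obtain ⟨K, hK⟩ : ∃ K, K = LinearMap.ker f := ⟨_, rfl⟩
  obtain ⟨L, hL⟩ : ∃ L, L = (LinearMap.range f).comap g := ⟨_, rfl⟩
  have hfK : ∀ x ∈ K, f x = 0 := fun x hx => by rwa [hK] at hx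
  have hgL : ∀ x ∈ L, ∃ y, f y = g x := fun x hx => by rwa [hL] at hx
  have hdisj : Disjoint L K := by
    rw [Submodule.disjoint_def]
    intro x hx hx'
    obtain ⟨y, hy⟩ := hgL x hx
    exact hfg x y (hfK x hx') hy.symm
  have hcompl : IsCompl L K := by
    refine ⟨hdisj, codisjoint_iff.mpr (Submodule.eq_top_of_disjoint _ _ ?_ hdisj)⟩
    have h1 : L = LinearMap.ker ((LinearMap.range f).mkQ ∘ₗ g) := by
      rw [hL, LinearMap.ker_comp, Submodule.ker_mkQ]
    have h2 := LinearMap.finrank_range_add_finrank_ker ((LinearMap.range f).mkQ ∘ₗ g)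
    have h3 := Submodule.finrank_le (LinearMap.range ((LinearMap.range f).mkQ ∘ₗ g))
    have h4 := Submodule.finrank_quotient_add_finrank (LinearMap.range f)
    have h5 := LinearMap.finrank_range_add_finrank_ker f
    rw [← h1] at h2
    rw [← hK] at h5
    omega
  obtain ⟨h, hhL, hhK⟩ : ∃ h : V →ₗ[ℝ] V, (∀ x ∈ L, h x = f x) ∧ ∀ x ∈ K, h x = g x := by
    refine ⟨f + g ∘ₗ K.projection L hcompl.symm, fun x hx => ?_, fun x hx => ?_⟩
    · have : K.projection L hcompl.symm x = 0 := by
        rw [Submodule.projection_apply_eq_zero_iff]; exact hx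
      simp [this]
    · have : K.projection L hcompl.symm x = x :=
        Submodule.projection_apply_left hcompl.symm ⟨x, hx⟩
      simp [this, hfK x hx]
  have hdecomp : ∀ x, ∃ y ∈ L, ∃ z ∈ K, y + z = x := fun x =>
    Submodule.mem_sup.mp (by rw [hcompl.sup_eq_top]; trivial)
  have hinj : Function.Injective h := by
    rw [injective_iff_map_eq_zero]
    intro x hx
    obtain ⟨y, hy, z, hz, rfl⟩ := hdecomp x
    rw [map_add, hhL y hy, hhK z hz] at hx
    have hz0 : z = 0 := by
      refine hfg z (-y) (hfK z hz) ?_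
      rw [map_neg]
      exact (neg_eq_of_add_eq_zero_right hx).symm
    subst hz0
    have hyK : y ∈ K := by simpa [hK] using hx
    rw [Submodule.disjoint_def.mp hdisj y hy hyK, add_zero]
  obtain ⟨b, hbl, hbr, hbz⟩ : ∃ b : Module.Basis (Fin (Module.finrank ℝ L) ⊕
      Fin (Module.finrank ℝ K)) ℝ V, (∀ i, b (Sum.inl i) ∈ L) ∧ (∀ i, b (Sum.inr i) ∈ K) ∧
      ∀ x ∈ L, ∀ j, b.repr x (Sum.inr j) = 0 := by
    refine ⟨((Module.finBasis ℝ L).prod (Module.finBasis ℝ K)).map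
      (Submodule.prodEquivOfIsCompl L K hcompl), fun i => by simp, fun i => by simp,
      fun x hx j => ?_⟩
    have : (Submodule.prodEquivOfIsCompl L K hcompl).symm x = (⟨x, hx⟩, 0) := by
      rw [LinearEquiv.symm_apply_eq]; simp
    simp [this]
  obtain ⟨c, hc, hcr⟩ : ∃ c : Module.Basis (Fin (Module.finrank ℝ L) ⊕
      Fin (Module.finrank ℝ K)) ℝ V, (∀ i, c i = h (b i)) ∧ ∀ x, c.repr (h x) = b.repr x :=
    ⟨b.map (LinearEquiv.ofInjectiveEndo h hinj), fun i => by simp, fun x => by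
      change (b.map (LinearEquiv.ofInjectiveEndo h hinj)).repr
        (LinearEquiv.ofInjectiveEndo h hinj x) = _
      simp only [Module.Basis.map_repr, LinearEquiv.trans_apply, LinearEquiv.symm_apply_apply]⟩
  refine ⟨_, _, b, c, fun i => ?_, fun i => hfK _ (hbr i), fun i => ?_, fun i j => ?_⟩
  · rw [hc, hhL _ (hbl i)]
  · rw [hc, hhK _ (hbr i)]
  · obtain ⟨y, hy⟩ := hgL _ (hbl i)
    obtain ⟨y₁, hy₁, y₂, hy₂, rfl⟩ := hdecomp y
    rw [← hy, map_add, hfK _ hy₂, add_zero, ← hhL y₁ hy₁, hcr]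
    exact hbz y₁ hy₁ j

/-- A pencil is regular and impulse-free as soon as `A` maps no nonzero kernel vector of `E` into
the range of `E`. -/
lemma regularImpulseFree_of_ker {n : ℕ} (E A : Matrix (Fin n) (Fin n) ℝ)
    (hEA : ∀ x y : Fin n → ℝ, E *ᵥ x = 0 → A *ᵥ x = E *ᵥ y → x = 0) :
    RegularImpulseFree E A := by
  obtain ⟨k, l, b, c, hfl, hfr, hgr, hgl⟩ :=
    exists_bases_of_ker (Matrix.toLin' E) (Matrix.toLin' A) (by simpa using hEA)
  have hn : n = k + l := by
    simpa using Module.finrank_eq_card_basis b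
  let std := Pi.basisFun ℝ (Fin n)
  have hsub : ∀ X : Matrix (Fin n) (Fin n) ℝ,
      ((c.reindex (blockEquiv hn)).toMatrix std * X *
        std.toMatrix (b.reindex (blockEquiv hn))).submatrix (blockEquiv hn) (blockEquiv hn) =
        LinearMap.toMatrix b c (Matrix.toLin' X) := by
    intro X
    have h1 : X = LinearMap.toMatrix std std (Matrix.toLin' X) := by
      change X = LinearMap.toMatrix (Pi.basisFun ℝ _) (Pi.basisFun ℝ _) (Matrix.toLin' X)
      rw [LinearMap.toMatrix_eq_toMatrix', LinearMap.toMatrix'_toLin']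
    conv_lhs => rw [h1]
    rw [basis_toMatrix_mul_linearMap_toMatrix_mul_basis_toMatrix]
    ext i j
    simp [LinearMap.toMatrix_apply]
  refine ⟨k, l, hn, (c.reindex (blockEquiv hn)).toMatrix std,
    std.toMatrix (b.reindex (blockEquiv hn)),
    (LinearMap.toMatrix b c (Matrix.toLin' A)).toBlocks₁₁, ?_, ?_, ?_, ?_⟩
  · exact IsUnit.of_mul_eq_one _ (Module.Basis.toMatrix_mul_toMatrix_flip _ _)
  · exact IsUnit.of_mul_eq_one _ (Module.Basis.toMatrix_mul_toMatrix_flip _ _)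
  · refine (hsub E).trans ?_
    ext i j
    rw [LinearMap.toMatrix_apply]
    rcases j with j | j
    · rw [hfl, c.repr_self, Finsupp.single_apply]
      rcases i with i | i <;> simp [Matrix.one_apply, eq_comm]
    · rw [hfr]
      rcases i with i | i <;> simp
  · refine (hsub A).trans ?_
    ext i j
    rcases j with j | j
    · rcases i with i | i
      · rfl
      · rw [LinearMap.toMatrix_apply, hgl]; simp
    · rw [LinearMap.toMatrix_apply, hgr, c.repr_self, Finsupp.single_apply]
      rcases i with i | i <;> simp [Matrix.one_apply, eq_comm]

/-- The canonical form of a regular impulse-free pencil, phrased with an orthogonal projection. -/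
lemma RegularImpulseFree.exists_projection {n : ℕ} {E A : Matrix (Fin n) (Fin n) ℝ}
    (h : RegularImpulseFree E A) :
    ∃ M N Mi Ni e a : Matrix (Fin n) (Fin n) ℝ, M * Mi = 1 ∧ Mi * M = 1 ∧ N * Ni = 1 ∧
      Ni * N = 1 ∧ M * E * N = e ∧ M * A * N = a ∧ e * e = e ∧ eᵀ = e ∧
      a = e * a * e + (1 - e) := by
  obtain ⟨k, l, hn, M, N, A₁, hM, hN, hE, hA⟩ := h
  obtain ⟨Mi, h1, h2⟩ := isUnit_iff_exists.mp hM
  obtain ⟨Ni, h3, h4⟩ := isUnit_iff_exists.mp hN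
  have hsub : ∀ X Y : Matrix (Fin n) (Fin n) ℝ,
      X.submatrix (blockEquiv hn) (blockEquiv hn) = Y.submatrix (blockEquiv hn) (blockEquiv hn) →
      X = Y := fun X Y hXY => (Matrix.reindex (blockEquiv hn).symm (blockEquiv hn).symm).injective hXY
  have hmul : ∀ X Y : Matrix (Fin n) (Fin n) ℝ,
      (X * Y).submatrix (blockEquiv hn) (blockEquiv hn) =
        X.submatrix (blockEquiv hn) (blockEquiv hn) *
          Y.submatrix (blockEquiv hn) (blockEquiv hn) := fun X Y =>
    (Matrix.submatrix_mul_equiv _ _ _ _ _).symm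
  refine ⟨M, N, Mi, Ni, M * E * N, M * A * N, h1, h2, h3, h4, rfl, rfl, hsub _ _ ?_, hsub _ _ ?_,
    hsub _ _ ?_⟩
  · rw [hmul, hE, fromBlocks_multiply]; simp
  · rw [← Matrix.transpose_submatrix, hE, fromBlocks_transpose]; simp
  · rw [Matrix.submatrix_add, Matrix.submatrix_sub, Pi.add_apply, Pi.add_apply, Pi.sub_apply,
      Pi.sub_apply, hmul (M * E * N * (M * A * N)), hmul (M * E * N), hE, hA, Matrix.submatrix_one_equiv, ← fromBlocks_one,
      fromBlocks_multiply, fromBlocks_multiply, sub_eq_add_neg, fromBlocks_neg, fromBlocks_add,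
      fromBlocks_add]
    simp

/-- The columns of a full-rank annihilator `E₀` of `Eᵀ` span its kernel. -/
lemma exists_eq_mul_of_transpose_mul_eq_zero {n r : ℕ} {E : Matrix (Fin n) (Fin n) ℝ}
    (hr : E.rank = r) {E₀ : Matrix (Fin n) (Fin (n - r)) ℝ} (hE₀rank : E₀.rank = n - r)
    (hEE₀ : Eᵀ * E₀ = 0) (X : Matrix (Fin n) (Fin n) ℝ) (hX : Eᵀ * X = 0) :
    ∃ Q : Matrix (Fin (n - r)) (Fin n) ℝ, X = E₀ * Q := by
  have hle : LinearMap.range E₀.mulVecLin ≤ LinearMap.ker (Eᵀ).mulVecLin := by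
    rintro _ ⟨x, rfl⟩
    rw [LinearMap.mem_ker, mulVecLin_apply, mulVecLin_apply, mulVec_mulVec, hEE₀, zero_mulVec]
  have heq : LinearMap.range E₀.mulVecLin = LinearMap.ker (Eᵀ).mulVecLin := by
    apply Submodule.eq_of_le_of_finrank_eq hle
    have h1 := LinearMap.finrank_range_add_finrank_ker (Eᵀ).mulVecLin
    have h2 : Module.finrank ℝ (LinearMap.range (Eᵀ).mulVecLin) = r :=
      (Matrix.rank_transpose E).trans hr
    have h3 : Module.finrank ℝ (LinearMap.range E₀.mulVecLin) = n - r := hE₀rank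
    rw [h2, Module.finrank_fin_fun] at h1
    omega
  have hcol : ∀ j, ∃ q, E₀ *ᵥ q = X.col j := fun j => by
    have : X.col j ∈ LinearMap.range E₀.mulVecLin := by
      rw [heq, LinearMap.mem_ker, mulVecLin_apply]
      ext i
      simpa [Matrix.mul_apply, mulVec, dotProduct] using congrFun (congrFun hX i) j
    exact this
  choose q hq using hcol
  refine ⟨Matrix.of fun i j => q j i, ?_⟩
  ext i j
  exact (congrFun (hq j) i).symm

lemma det_smul_map_sub_map_eq_zero_iff {n : ℕ} (E A : Matrix (Fin n) (Fin n) ℝ) (μ : ℂ) :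
    (μ • E.map Complex.ofReal - A.map Complex.ofReal).det = 0 ↔
      ∃ v, v ≠ 0 ∧ A.map Complex.ofReal *ᵥ v = μ • (E.map Complex.ofReal *ᵥ v) := by
  rw [← Matrix.exists_mulVec_eq_zero_iff]
  refine exists_congr fun v => and_congr_right fun _ => ?_
  rw [sub_mulVec, smul_mulVec, sub_eq_zero, eq_comm]

lemma admissible_of_complexForm {n : ℕ} {α : ℝ} (hα₁ : 1 < α) (hα₂ : α < 2)
    (E A P X : Matrix (Fin n) (Fin n) ℝ) (hP : P.PosDef) (hXE : X * E = 0)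
    (h : ∀ v : Fin n → ℂ, v ≠ 0 →
      (sectorRotation α * complexForm (Eᵀ * P * A) v + complexForm (X * A) v).re < 0) :
    Admissible E A α := by
  have hET : (Eᵀ).map Complex.ofReal = (E.map Complex.ofReal)ᴴ := by
    ext i j; simp
  have hform : ∀ v, complexForm (Eᵀ * P * A) v = star (E.map Complex.ofReal *ᵥ v) ⬝ᵥ
      (P.map Complex.ofReal *ᵥ (A.map Complex.ofReal *ᵥ v)) := fun v => by
    simp only [complexForm, map_ofReal_mul, hET, ← mulVec_mulVec]
    rw [dotProduct_mulVec, star_mulVec]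
  refine ⟨regularImpulseFree_of_ker E A fun x y hx hxy => ?_, fun μ hμ => ?_⟩
  · by_contra hx0
    have hmap : ∀ (Y : Matrix (Fin n) (Fin n) ℝ) (z : Fin n → ℝ),
        Y.map Complex.ofReal *ᵥ (fun i => (z i : ℂ)) = fun i => ((Y *ᵥ z) i : ℂ) := fun Y z => by
      ext i; simp [mulVec, dotProduct]
    have h1 := h (fun i => (x i : ℂ)) fun h0 => hx0 (funext fun i => by simpa using congrFun h0 i)
    have h2 : X *ᵥ (A *ᵥ x) = 0 := by rw [hxy, mulVec_mulVec, hXE, zero_mulVec]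
    rw [hform, complexForm, hmap, hmap (X * A), hx, ← mulVec_mulVec, h2] at h1
    simp [dotProduct] at h1
  · obtain ⟨v, hv, hAv⟩ := (det_smul_map_sub_map_eq_zero_iff E A μ).mp hμ
    have key : ∀ (ν : ℂ) (u : Fin n → ℂ), u ≠ 0 →
        A.map Complex.ofReal *ᵥ u = ν • (E.map Complex.ofReal *ᵥ u) →
        (sectorRotation α * ν).re < 0 := by
      intro ν u hu hAu
      have h1 := h u hu
      have h2 : complexForm (X * A) u = 0 := by
        rw [complexForm, map_ofReal_mul, ← mulVec_mulVec, hAu, mulVec_smul, mulVec_mulVec,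
          ← map_ofReal_mul, hXE]
        simp [dotProduct]
      obtain ⟨q, hq0, hq⟩ := hP.complexForm_eq (E.map Complex.ofReal *ᵥ u)
      have h3 : complexForm (Eᵀ * P * A) u = ν * q := by
        rw [hform, hAu, mulVec_smul, dotProduct_smul, ← hq, complexForm, smul_eq_mul]
      rw [h2, h3, add_zero, ← mul_assoc, Complex.re_mul_ofReal] at h1
      by_contra! h4
      exact absurd h1 (not_lt.mpr (mul_nonneg h4 hq0))
    have hstar : ∀ Y : Matrix (Fin n) (Fin n) ℝ,
        Y.map Complex.ofReal *ᵥ star v = star (Y.map Complex.ofReal *ᵥ v) := fun Y => by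
      ext i; simp [mulVec, dotProduct]
    rw [lt_abs_arg_iff hα₁ hα₂]
    refine ⟨key μ v hv hAv, ?_⟩
    have h1 := key (star μ) (star v) (star_ne_zero.mpr hv) (by
      rw [hstar, hstar, hAv, star_smul])
    simpa [Complex.mul_re] using h1

lemma Admissible.exists_posDef {n r : ℕ} {α : ℝ} (hα₁ : 1 < α) (hα₂ : α < 2)
    {E A : Matrix (Fin n) (Fin n) ℝ} (hr : E.rank = r)
    {E₀ : Matrix (Fin n) (Fin (n - r)) ℝ} (hE₀rank : E₀.rank = n - r)
    (hEE₀ : Eᵀ * E₀ = 0) (hadm : Admissible E A α) :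
    ∃ (P : Matrix (Fin n) (Fin n) ℝ) (Q₀ : Matrix (Fin (n - r)) (Fin n) ℝ), P.PosDef ∧
      ∀ v : Fin n → ℂ, v ≠ 0 →
        (sectorRotation α * complexForm (Eᵀ * P * A) v + complexForm (Q₀ᵀ * E₀ᵀ * A) v).re < 0 := by
  obtain ⟨hreg, hspec⟩ := hadm
  obtain ⟨M, N, Mi, Ni, e, a, hMMi, hMiM, hNNi, hNiN, he, ha, hee, heT, hae⟩ :=
    hreg.exists_projection
  have hEe : E = Mi * e * Ni := by
    rw [← he]
    calc E = (Mi * M) * E * (N * Ni) := by rw [hMiM, hNNi, one_mul, mul_one]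
      _ = _ := by noncomm_ring
  have he0 : e * (1 - e) = 0 := by rw [mul_sub, mul_one, hee, sub_self]
  have he0' : (1 - e) * e = 0 := by rw [sub_mul, one_mul, hee, sub_self]
  have hff : (1 - e) * (1 - e) = 1 - e := by rw [mul_sub, mul_one, he0', sub_zero]
  have hfT : (1 - e)ᵀ = 1 - e := by rw [transpose_sub, transpose_one, heT]
  have hea : e * a = e * a * e := by
    conv_lhs => rw [hae]
    rw [mul_add, he0, add_zero, ← mul_assoc, ← mul_assoc, hee]
  have hfa : (1 - e) * a = 1 - e := by
    conv_lhs => rw [hae]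
    rw [mul_add, hff, ← mul_assoc, ← mul_assoc, he0', zero_mul, zero_mul, zero_add]
  have hae' : a * e = e * a * e := by
    conv_lhs => rw [hae]
    rw [add_mul, he0', add_zero, mul_assoc, hee]
  obtain ⟨P, hP, hPneg⟩ := exists_posDef_complexForm_neg (sectorRotation α) (e * a * e - (1 - e)) (by
    intro μ v hv hμ
    rw [← lt_abs_arg_iff hα₁ hα₂]
    by_cases hfv : (1 - e).map Complex.ofReal *ᵥ v = 0
    · have hev : e.map Complex.ofReal *ᵥ v = v := by
        have h1 : ((1 - e) + e).map Complex.ofReal *ᵥ v = v := by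
          rw [sub_add_cancel, Matrix.map_one _ Complex.ofReal_zero Complex.ofReal_one, one_mulVec]
        rwa [Matrix.map_add _ Complex.ofReal_add, add_mulVec, hfv, zero_add] at h1
      have hav : a.map Complex.ofReal *ᵥ v = μ • v := by
        rw [← hμ, Matrix.map_sub _ Complex.ofReal_sub, sub_mulVec, hfv, sub_zero, ← hae',
          map_ofReal_mul, ← mulVec_mulVec, hev]
      apply hspec
      rw [det_smul_map_sub_map_eq_zero_iff]
      refine ⟨N.map Complex.ofReal *ᵥ v, fun h0 => hv ?_, ?_⟩
      · have := congrArg (Ni.map Complex.ofReal *ᵥ ·) h0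
        simpa [← map_ofReal_mul, hNiN, Matrix.map_one _ Complex.ofReal_zero Complex.ofReal_one]
          using this
      · have hAN : A * N = Mi * a := by rw [← ha, ← mul_assoc, ← mul_assoc, hMiM, one_mul]
        have hEN : E * N = Mi * e := by rw [hEe, mul_assoc, hNiN, mul_one]
        rw [mulVec_mulVec, mulVec_mulVec, ← map_ofReal_mul, ← map_ofReal_mul, hAN, hEN,
          map_ofReal_mul, map_ofReal_mul, ← mulVec_mulVec, ← mulVec_mulVec, hav, hev, mulVec_smul]
    · have h1 := congrArg ((1 - e).map Complex.ofReal *ᵥ ·) hμ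
      have h2 : (1 - e) * (e * a * e - (1 - e)) = -(1 - e) := by
        rw [mul_sub, hff, ← mul_assoc, ← mul_assoc, he0', zero_mul, zero_mul, zero_sub]
      simp only [mulVec_mulVec, ← map_ofReal_mul, h2, mulVec_smul] at h1
      rw [Matrix.map_neg _ Complex.ofReal_neg, neg_mulVec, ← neg_one_smul ℂ, ← sub_eq_zero,
        ← sub_smul, smul_eq_zero, or_iff_left hfv, sub_eq_zero] at h1
      rw [← h1, Complex.arg_neg_one, abs_of_pos Real.pi_pos]
      nlinarith [Real.pi_pos])
  obtain ⟨Q₀, hQ₀⟩ := exists_eq_mul_of_transpose_mul_eq_zero hr hE₀rank hEE₀ (-(Mᵀ * (1 - e) * Ni))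
    (by
      have h1 : Eᵀ * Mᵀ * (1 - e) = 0 := by
        rw [← transpose_mul, hEe, ← mul_assoc, ← mul_assoc, hMMi, one_mul, transpose_mul, heT,
          mul_assoc, he0, mul_zero]
      rw [mul_neg, ← mul_assoc, ← mul_assoc, h1, zero_mul, neg_zero])
  have hQE : Q₀ᵀ * E₀ᵀ = -(Niᵀ * (1 - e) * M) := by
    rw [← transpose_mul, ← hQ₀, transpose_neg, transpose_mul, transpose_mul, hfT,
      transpose_transpose, mul_assoc]
  have hR : (e * P * e + (1 - e)).PosDef := by
    have hePe : eᵀ * P * e = e * P * e := by rw [heT]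
    have hfff : (1 - e)ᵀ * (1 : Matrix (Fin n) (Fin n) ℝ) * (1 - e) = 1 - e := by
      rw [hfT, mul_one, hff]
    refine posDef_iff_dotProduct_mulVec.mpr ⟨?_, fun x hx => ?_⟩
    · have hPT : Pᵀ = P := by
        rw [← conjTranspose_eq_transpose_of_trivial]; exact hP.isHermitian
      rw [IsHermitian, conjTranspose_eq_transpose_of_trivial, transpose_add, hfT, transpose_mul,
        transpose_mul, heT, hPT, mul_assoc]
    · have hq : ∀ X Y : Matrix (Fin n) (Fin n) ℝ,
          x ⬝ᵥ ((Yᵀ * X * Y) *ᵥ x) = (Y *ᵥ x) ⬝ᵥ (X *ᵥ (Y *ᵥ x)) := fun X Y => by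
        rw [← mulVec_mulVec, ← mulVec_mulVec, dotProduct_mulVec, vecMul_transpose]
      rw [star_trivial, add_mulVec, dotProduct_add, ← hePe, ← hfff, hq, hq]
      by_cases hex : e *ᵥ x = 0
      · have : (1 - e) *ᵥ x = x := by rw [sub_mulVec, one_mulVec, hex, sub_zero]
        rw [hex, this]
        simpa using (PosDef.one (n := Fin n) (R := ℝ)).dotProduct_mulVec_pos hx
      · have h0 := (PosDef.one (n := Fin n) (R := ℝ)).posSemidef.dotProduct_mulVec_nonneg
          ((1 - e) *ᵥ x)
        exact add_pos_of_pos_of_nonneg (by simpa using hP.dotProduct_mulVec_pos hex)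
          (by simpa using h0)
  refine ⟨Mᵀ * (e * P * e + (1 - e)) * M, Q₀, ?_, fun v hv => ?_⟩
  · have hMinj : Function.Injective M.mulVec :=
      Matrix.mulVec_injective_of_isUnit (IsUnit.of_mul_eq_one _ hMMi)
    simpa [conjTranspose_eq_transpose_of_trivial] using hR.conjTranspose_mul_mul_same hMinj
  set u := Ni.map Complex.ofReal *ᵥ v with hu
  have hu0 : u ≠ 0 := fun h0 => hv <| by
    have := congrArg (N.map Complex.ofReal *ᵥ ·) h0
    simpa [hu, ← map_ofReal_mul, hNNi, Matrix.map_one _ Complex.ofReal_zero Complex.ofReal_one]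
      using this
  have haA : A = Mi * a * Ni := by
    rw [← ha]
    calc A = (Mi * M) * A * (N * Ni) := by rw [hMiM, hNNi, one_mul, mul_one]
      _ = _ := by noncomm_ring
  have hMA : M * A = a * Ni := by rw [haA, ← mul_assoc, ← mul_assoc, hMMi, one_mul]
  have hME : M * E = e * Ni := by rw [hEe, ← mul_assoc, ← mul_assoc, hMMi, one_mul]
  have hY : Eᵀ * (Mᵀ * (e * P * e + (1 - e)) * M) * A =
      Niᵀ * (eᵀ * (P * (e * a * e - (1 - e))) * e) * Ni := by
    have h1 : e * (e * P * e + (1 - e)) * a = e * (P * (e * a * e - (1 - e))) * e := by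
      have h2 : e * (P * (e * a * e - (1 - e))) * e = e * P * (e * a * (e * e)) := by
        rw [mul_assoc, mul_assoc P, sub_mul, he0', sub_zero]
        noncomm_ring
      have h3 : e * (e * P * e + (1 - e)) = e * P * e := by
        rw [mul_add, he0, add_zero, ← mul_assoc, ← mul_assoc, hee]
      rw [h2, h3, hee, ← hea, mul_assoc]
    calc _ = (M * E)ᵀ * (e * P * e + (1 - e)) * (M * A) := by
          rw [transpose_mul]; noncomm_ring
      _ = Niᵀ * (e * (e * P * e + (1 - e)) * a) * Ni := by
          rw [hME, hMA, transpose_mul, heT]; noncomm_ring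
      _ = _ := by rw [h1, heT]
  have hZ : Q₀ᵀ * E₀ᵀ * A = Niᵀ * (-((1 - e)ᵀ * 1 * (1 - e))) * Ni := by
    have h1 : (1 - e)ᵀ * 1 * (1 - e) = (1 - e) * a := by rw [hfT, mul_one, hff, hfa]
    rw [hQE, h1, neg_mul, mul_assoc, hMA]
    noncomm_ring
  rw [hY, hZ, complexForm_transpose_mul_mul, complexForm_transpose_mul_mul,
    complexForm_transpose_mul_mul, complexForm_neg, complexForm_transpose_mul_mul, ← hu, Complex.add_re,
    Complex.neg_re]
  by_cases heu : e.map Complex.ofReal *ᵥ u = 0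
  · have h1 : (1 - e).map Complex.ofReal *ᵥ u = u := by
      rw [Matrix.map_sub _ Complex.ofReal_sub, sub_mulVec, heu, sub_zero,
        Matrix.map_one _ Complex.ofReal_zero Complex.ofReal_one, one_mulVec]
    have h2 : ∀ X : Matrix (Fin n) (Fin n) ℝ, complexForm X 0 = 0 := fun X => by
      simp [complexForm]
    rw [heu, h1, h2]
    simpa using complexForm_one_re_pos hu0
  · linarith [hPneg _ heu, complexForm_one_re_nonneg ((1 - e).map Complex.ofReal *ᵥ u)]

/-- `(E, A, α)` with `1 < α < 2` is admissible iff there exist `P = Pᵀ > 0`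
and `Q₀` with `Sym{Θ⊗(EᵀPA) + I₂⊗(Q₀ᵀE₀ᵀA)} < 0`, where `E₀` has full column rank and
`EᵀE₀ = 0`. -/
theorem stmt_8 {n r : ℕ} (α : ℝ) (hα₁ : 1 < α) (hα₂ : α < 2)
    (E A : Matrix (Fin n) (Fin n) ℝ) (hr : E.rank = r)
    (E₀ : Matrix (Fin n) (Fin (n - r)) ℝ) (hE₀rank : E₀.rank = n - r)
    (hEE₀ : Eᵀ * E₀ = 0) :
    Admissible E A α ↔
    ∃ (P : Matrix (Fin n) (Fin n) ℝ) (Q₀ : Matrix (Fin (n - r)) (Fin n) ℝ),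
      P.PosDef ∧
      NegDef (matSym (Θmat α ⊗ₖ (Eᵀ * P * A) +
        (1 : Matrix (Fin 2) (Fin 2) ℝ) ⊗ₖ (Q₀ᵀ * E₀ᵀ * A))) := by
  have hQE : ∀ Q₀ : Matrix (Fin (n - r)) (Fin n) ℝ, Q₀ᵀ * E₀ᵀ * E = 0 := fun Q₀ => by
    have : E₀ᵀ * E = 0 := by simpa using congrArg Matrix.transpose hEE₀
    rw [Matrix.mul_assoc, this, Matrix.mul_zero]
  simp only [negDef_kronecker_iff]
  constructor
  · exact fun h => h.exists_posDef hα₁ hα₂ hr hE₀rank hEE₀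
  · rintro ⟨P, Q₀, hP, h⟩
    exact admissible_of_complexForm hα₁ hα₂ E A P _ hP (hQE Q₀) h
end

section
/- Let 1 < α < 2 and E, A ∈ ℝ^{n×n}. If there exist a symmetric positive definite matrix P ∈ ℝ^{n×n} and a symmetric matrix Q ∈ ℝ^{n×n} such that Sym{Θ⊗(AᵀPE)} + I₂⊗(AᵀQA) is negative definite and EᵀQE is positive semidefinite, where Θ = [[sin(απ/2), −cos(απ/2)], [cos(απ/2), sin(απ/2)]], then for all vectors υ¹, υ² ∈ ℝⁿ satisfying Eυ¹ = 0 and Eυ² = Aυ¹ one has υ¹ = 0 (i.e., the pencil (E, A) has no infinite eigenvector of order 2). -/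
open Matrix Kronecker

/-- if `Sym{Θ⊗(AᵀPE)} + I₂⊗(AᵀQA) < 0` with `P = Pᵀ > 0`, `Q = Qᵀ`, and
`EᵀQE ≥ 0`, then the pencil `(E, A)` has no infinite eigenvector of order 2. -/
theorem stmt_10 {n : ℕ} (α : ℝ) (hα₁ : 1 < α) (hα₂ : α < 2)
    (E A : Matrix (Fin n) (Fin n) ℝ)
    (P Q : Matrix (Fin n) (Fin n) ℝ) (hP : P.PosDef) (hQ : Q.IsSymm)
    (hLMI : NegDef (matSym (Θmat α ⊗ₖ (Aᵀ * P * E)) +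
      (1 : Matrix (Fin 2) (Fin 2) ℝ) ⊗ₖ (Aᵀ * Q * A)))
    (hQE : (Eᵀ * Q * E).PosSemidef) :
    ∀ υ₁ υ₂ : Fin n → ℝ, E *ᵥ υ₁ = 0 → E *ᵥ υ₂ = A *ᵥ υ₁ → υ₁ = 0 := by
  intro v₁ v₂ h₁ h₂
  by_contra hv
  have hblock : (-(matSym (Θmat α ⊗ₖ (Aᵀ * P * E)) +
      (1 : Matrix (Fin 2) (Fin 2) ℝ) ⊗ₖ (Aᵀ * Q * A))).submatrix
        (fun i : Fin n => ((0 : Fin 2), i)) (fun i : Fin n => ((0 : Fin 2), i)) =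
      -(Real.sin (α * Real.pi / 2) • matSym (Aᵀ * P * E) + Aᵀ * Q * A) := by
    ext i j
    simp [-transpose_mul, matSym, Θmat]
  have hneg := PosDef.submatrix hLMI (e := fun i : Fin n => ((0 : Fin 2), i))
    (Prod.mk_right_injective 0)
  rw [hblock] at hneg
  have hpos := hneg.dotProduct_mulVec_pos hv
  have hnonneg := hQE.dotProduct_mulVec_nonneg v₂
  have hPE : v₁ ⬝ᵥ (Aᵀ * P * E) *ᵥ v₁ = 0 := by
    rw [← mulVec_mulVec, h₁, mulVec_zero, dotProduct_zero]
  have hPE' : v₁ ⬝ᵥ (Aᵀ * P * E)ᵀ *ᵥ v₁ = 0 := by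
    rw [mulVec_transpose, dotProduct_comm, ← dotProduct_mulVec, hPE]
  have hQ_eq : v₂ ⬝ᵥ (Eᵀ * Q * E) *ᵥ v₂ = v₁ ⬝ᵥ (Aᵀ * Q * A) *ᵥ v₁ := by
    simp only [← mulVec_mulVec, h₂, dotProduct_mulVec, vecMul_transpose]
  simp only [star_trivial, neg_mulVec, add_mulVec, smul_mulVec, matSym, dotProduct_neg,
    dotProduct_add, dotProduct_smul, hPE, hPE'] at hpos
  rw [star_trivial, hQ_eq] at hnonneg
  simp only [smul_eq_mul, add_zero, mul_zero, zero_add] at hpos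
  linarith
end
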